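/- arXiv:2006.16398 — 3 statements merged into one kernel-verified Lean document; each statement's English description precedes it below -/
import Mathlib

section
/- (Theorem 1) Suppose φ'' ∈ WLSC(α−2, c, x₀) for some c ∈ (0,1], x₀ ≥ 0 and α > 0. Then for every t > 0 the measure μ_t is absolutely continuous with respect to Lebesgue measure; denoting its density by p(t,·), for each ε > 0 there is M₀ > 0 such that |p(t, −tφ'(w)) · √(2π t φ''(w)) · exp{t(w φ'(w) − φ(w))} − 1| ≤ ε whenever w > x₀ and t w² φ''(w) > M₀. -/
open MeasureTheory Real Set Filter

noncomputable section

/-- Weak lower scaling property at infinity: `f(l*x) ≥ c * l^τ * f(x)` for `l ≥ 1`, `x > x₁`. -/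
def WLSC (f : ℝ → ℝ) (τ c x₁ : ℝ) : Prop :=
  ∀ l : ℝ, 1 ≤ l → ∀ x : ℝ, x₁ < x → c * l ^ τ * f x ≤ f (l * x)

/-- Weak upper scaling property at infinity: `f(l*x) ≤ C * l^τ * f(x)` for `l ≥ 1`, `x > x₁`. -/
def WUSC (f : ℝ → ℝ) (τ C x₁ : ℝ) : Prop :=
  ∀ l : ℝ, 1 ≤ l → ∀ x : ℝ, x₁ < x → f (l * x) ≤ C * l ^ τ * f x

/-- The Pruitt function `K(r) = σ²/r² + r⁻² ∫_{(0,r)} s² ν(ds)`. -/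
def pruittK (σ : ℝ) (ν : Measure ℝ) (r : ℝ) : ℝ :=
  σ ^ 2 / r ^ 2 + (∫ s in Ioo (0:ℝ) r, s ^ 2 ∂ν) / r ^ 2

/-- The Pruitt function `h(r) = σ²/r² + ∫_{(0,∞)} min(1, s²/r²) ν(ds)`. -/
def pruittH (σ : ℝ) (ν : Measure ℝ) (r : ℝ) : ℝ :=
  σ ^ 2 / r ^ 2 + ∫ s in Ioi (0:ℝ), min 1 (s ^ 2 / r ^ 2) ∂ν

/-- The real part of the characteristic exponent:
`Re ψ(ξ) = σ²ξ² + ∫_{(0,∞)} (1 − cos(ξx)) ν(dx)`. -/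
def rePsi (σ : ℝ) (ν : Measure ℝ) (ξ : ℝ) : ℝ :=
  σ ^ 2 * ξ ^ 2 + ∫ x in Ioi (0:ℝ), (1 - Real.cos (ξ * x)) ∂ν

/-- `ψ*(r) = sup_{|z| ≤ r} Re ψ(z)`. -/
def psiStar (σ : ℝ) (ν : Measure ℝ) (r : ℝ) : ℝ :=
  sSup (rePsi σ ν '' {z : ℝ | |z| ≤ r})

/-- `ψ⁻¹(s) = sup{r > 0 : ψ*(r) = s}`. -/
def psiInv (σ : ℝ) (ν : Measure ℝ) (s : ℝ) : ℝ :=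
  sSup {r : ℝ | 0 < r ∧ psiStar σ ν r = s}

/-- `Φ(x) = x² φ''(x)`. -/
def bigPhi (φ'' : ℝ → ℝ) (x : ℝ) : ℝ := x ^ 2 * φ'' x

/-- `Φ*(r) = sup_{0 < s ≤ r} Φ(s)`. -/
def bigPhiStar (φ'' : ℝ → ℝ) (r : ℝ) : ℝ := sSup (bigPhi φ'' '' Ioc (0:ℝ) r)

/-- `Φ⁻¹(s) = sup{r > 0 : Φ*(r) = s}`. -/
def bigPhiInv (φ'' : ℝ → ℝ) (s : ℝ) : ℝ := sSup {r : ℝ | 0 < r ∧ bigPhiStar φ'' r = s}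

/-- The characteristic (Lévy–Khintchine) exponent
`ψ(ξ) = σ²ξ² − ibξ − ∫_{(0,∞)} (e^{iξx} − 1 − iξx 1_{x<1}) ν(dx)`. -/
def charExp (σ b : ℝ) (ν : Measure ℝ) (ξ : ℝ) : ℂ :=
  (σ : ℂ) ^ 2 * (ξ : ℂ) ^ 2 - Complex.I * (b : ℂ) * (ξ : ℂ) -
    ∫ x in Ioi (0:ℝ), (Complex.exp (Complex.I * (ξ : ℂ) * (x : ℂ)) - 1 -
      Complex.I * (ξ : ℂ) * (x : ℂ) * (if x < 1 then (1:ℂ) else 0)) ∂ν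

/-- The holomorphic extension of the Laplace exponent to `{Re z > 0}`. -/
def laplaceC (σ b : ℝ) (ν : Measure ℝ) (z : ℂ) : ℂ :=
  (σ : ℂ) ^ 2 * z ^ 2 - (b : ℂ) * z +
    ∫ x in Ioi (0:ℝ), (Complex.exp (-(z * (x : ℂ))) - 1 +
      z * (x : ℂ) * (if x < 1 then (1:ℂ) else 0)) ∂ν

/-- `b_r = b + ∫_{(0,∞)} s (1_{s<r} − 1_{s<1}) ν(ds)`. -/
def brFn (b : ℝ) (ν : Measure ℝ) (r : ℝ) : ℝ :=
  b + ∫ s in Ioi (0:ℝ), s * ((if s < r then (1:ℝ) else 0) - (if s < 1 then (1:ℝ) else 0)) ∂ν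

/-- The majorant `η`: `η(0) = ∞`, `η(s) = s⁻¹ Φ*(1/s)` for `0 < s < 1/x₀`,
and `η(s) = A s⁻¹ |φ(1/s)|` for `s ≥ 1/x₀`, where `A = Φ*(x₀)/|φ(x₀)|`. -/
def etaFn (φ φ'' : ℝ → ℝ) (x₀ : ℝ) (s : ℝ) : ENNReal :=
  if s ≤ 0 then ⊤
  else if x₀ * s < 1 then ENNReal.ofReal (s⁻¹ * bigPhiStar φ'' s⁻¹)
  else ENNReal.ofReal ((bigPhiStar φ'' x₀ / |φ x₀|) * s⁻¹ * |φ s⁻¹|)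


/-- A function dominated by a multiple of `min 1 x²` is integrable against a Lévy measure. -/
lemma integrable_of_norm_le_min_one_sq {E : Type*} [NormedAddCommGroup E] {m : Measure ℝ}
    (hm : Integrable (fun x : ℝ => min 1 (x ^ 2)) m) (hpos : ∀ᵐ x ∂m, 0 < x)
    {f : ℝ → E} (hf : AEStronglyMeasurable f m) (C : ℝ)
    (hC : ∀ x, 0 < x → ‖f x‖ ≤ C * min 1 (x ^ 2)) : Integrable f m := by
  refine (hm.const_mul C).mono' hf ?_
  filter_upwards [hpos] with x hx using hC x hx

/-- The integrand of `laplaceC`. -/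
def levyKernel (z : ℂ) (x : ℝ) : ℂ :=
  Complex.exp (-(z * (x : ℂ))) - 1 + z * (x : ℂ) * (if x < 1 then (1:ℂ) else 0)

lemma measurable_cutoff : Measurable (fun x : ℝ => if x < 1 then (1:ℂ) else 0) :=
  Measurable.ite measurableSet_Iio measurable_const measurable_const

lemma measurable_levyKernel (z : ℂ) : Measurable (levyKernel z) := by
  unfold levyKernel
  have := measurable_cutoff
  fun_prop

lemma norm_cexp_neg_sub_one_add_le (y : ℂ) :
    ‖Complex.exp (-y) - 1 + y‖ ≤ ‖y‖ ^ 2 * Real.exp ‖y‖ := by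
  have h := Complex.norm_exp_sub_sum_le_norm_mul_exp (-y) 2
  simp only [Finset.sum_range_succ, Finset.sum_range_zero, norm_neg] at h
  convert h using 2
  simp
  ring

lemma norm_levyKernel_le {z : ℂ} (hz : 0 ≤ z.re) {R : ℝ} (hR : ‖z‖ ≤ R) {x : ℝ} (hx : 0 < x) :
    ‖levyKernel z x‖ ≤ (2 + R ^ 2 * Real.exp R) * min 1 (x ^ 2) := by
  have hR0 : 0 ≤ R := (norm_nonneg z).trans hR
  unfold levyKernel
  by_cases h1 : x < 1
  · have hmin : min 1 (x ^ 2) = x ^ 2 := min_eq_right (by nlinarith)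
    rw [if_pos h1, mul_one, hmin]
    have hn : ‖z * (x : ℂ)‖ = ‖z‖ * x := by simp [abs_of_pos hx]
    refine (norm_cexp_neg_sub_one_add_le _).trans ?_
    rw [hn]
    have e1 : Real.exp (‖z‖ * x) ≤ Real.exp R := by
      apply Real.exp_le_exp.2
      nlinarith [norm_nonneg z]
    have e2 : (‖z‖ * x) ^ 2 ≤ R ^ 2 * x ^ 2 := by
      rw [mul_pow]; gcongr
    calc (‖z‖ * x) ^ 2 * Real.exp (‖z‖ * x) ≤ (R ^ 2 * x ^ 2) * Real.exp R := by gcongr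
      _ ≤ _ := by nlinarith [sq_nonneg x]
  · have hmin : min 1 (x ^ 2) = 1 := min_eq_left (by nlinarith)
    rw [if_neg h1, mul_zero, add_zero, hmin, mul_one]
    have e1 : ‖Complex.exp (-(z * (x : ℂ)))‖ ≤ 1 := by
      rw [Complex.norm_exp]
      apply Real.exp_le_one_iff.2
      simp
      positivity
    calc _ ≤ ‖Complex.exp (-(z * (x : ℂ)))‖ + ‖(1:ℂ)‖ := norm_sub_le _ _
      _ ≤ 2 := by rw [norm_one]; linarith
      _ ≤ _ := by have : 0 ≤ R ^ 2 * Real.exp R := by positivity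
                  linarith

lemma integrable_levyKernel {m : Measure ℝ}
    (hm : Integrable (fun x : ℝ => min 1 (x ^ 2)) m) (hpos : ∀ᵐ x ∂m, 0 < x)
    {z : ℂ} (hz : 0 ≤ z.re) : Integrable (levyKernel z) m :=
  integrable_of_norm_le_min_one_sq hm hpos (measurable_levyKernel z).aestronglyMeasurable
    (2 + ‖z‖ ^ 2 * Real.exp ‖z‖) fun _ hx => norm_levyKernel_le hz le_rfl hx

lemma continuousOn_integral_levyKernel {m : Measure ℝ}
    (hm : Integrable (fun x : ℝ => min 1 (x ^ 2)) m) (hpos : ∀ᵐ x ∂m, 0 < x) :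
    ContinuousOn (fun z => ∫ x, levyKernel z x ∂m) {z : ℂ | 0 ≤ z.re} := by
  intro z₀ _
  have hball : ∀ᶠ z in nhdsWithin z₀ {z : ℂ | 0 ≤ z.re}, ‖z‖ ≤ ‖z₀‖ + 1 := by
    apply mem_nhdsWithin_of_mem_nhds
    filter_upwards [Metric.ball_mem_nhds z₀ one_pos] with z hz
    have h1 : ‖z - z₀‖ < 1 := by simpa [dist_eq_norm] using hz
    have h2 := norm_sub_norm_le z z₀
    linarith
  refine tendsto_integral_filter_of_dominated_convergence
    (fun x => (2 + (‖z₀‖ + 1) ^ 2 * Real.exp (‖z₀‖ + 1)) * min 1 (x ^ 2)) ?_ ?_ ?_ ?_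
  · exact Eventually.of_forall fun z => (measurable_levyKernel z).aestronglyMeasurable
  · filter_upwards [hball, self_mem_nhdsWithin] with z hz hz0
    filter_upwards [hpos] with x hx using norm_levyKernel_le hz0 hz hx
  · exact hm.const_mul _
  · refine Eventually.of_forall fun x => ?_
    have : Continuous fun z => levyKernel z x := by unfold levyKernel; fun_prop
    exact this.continuousWithinAt

/-- The `z`-derivative of `levyKernel`. -/
def levyKernelDeriv (z : ℂ) (x : ℝ) : ℂ :=
  -(x : ℂ) * Complex.exp (-(z * (x : ℂ))) + (x : ℂ) * (if x < 1 then (1:ℂ) else 0)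

lemma measurable_levyKernelDeriv (z : ℂ) : Measurable (levyKernelDeriv z) := by
  unfold levyKernelDeriv
  have := measurable_cutoff
  fun_prop

lemma norm_levyKernelDeriv_le {z : ℂ} {δ R : ℝ} (hδ : 0 < δ) (hz : δ ≤ z.re) (hR : ‖z‖ ≤ R)
    {x : ℝ} (hx : 0 < x) :
    ‖levyKernelDeriv z x‖ ≤ (1 / δ + R * Real.exp R) * min 1 (x ^ 2) := by
  have hR0 : 0 ≤ R := (norm_nonneg z).trans hR
  unfold levyKernelDeriv
  by_cases h1 : x < 1
  · have hmin : min 1 (x ^ 2) = x ^ 2 := min_eq_right (by nlinarith)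
    rw [if_pos h1, mul_one, hmin]
    have hn : ‖z * (x : ℂ)‖ = ‖z‖ * x := by simp [abs_of_pos hx]
    have hb := Complex.norm_exp_sub_sum_le_norm_mul_exp (-(z * (x : ℂ))) 1
    simp only [Finset.sum_range_succ, Finset.sum_range_zero, norm_neg, hn] at hb
    have heq : -(x : ℂ) * Complex.exp (-(z * (x : ℂ))) + (x : ℂ)
        = -(x : ℂ) * (Complex.exp (-(z * (x : ℂ))) - 1) := by ring
    have hb' : ‖Complex.exp (-(z * (x : ℂ))) - 1‖ ≤ R * x * Real.exp R := by
      calc _ ≤ ‖z‖ * x * Real.exp (‖z‖ * x) := by simpa using hb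
        _ ≤ R * x * Real.exp R := by
          gcongr
          nlinarith [norm_nonneg z]
    rw [heq, norm_mul, norm_neg, Complex.norm_real, Real.norm_of_nonneg hx.le]
    have h3 : 0 ≤ 1 / δ * x ^ 2 := by positivity
    nlinarith
  · have hmin : min 1 (x ^ 2) = 1 := min_eq_left (by nlinarith)
    rw [if_neg h1, mul_zero, add_zero, hmin, mul_one, norm_mul, norm_neg, Complex.norm_real,
      Real.norm_of_nonneg hx.le, Complex.norm_exp]
    have e1 : (-(z * (x : ℂ))).re = -(z.re * x) := by simp
    rw [e1, Real.exp_neg]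
    have e2 : δ * x ≤ Real.exp (z.re * x) := by
      have := Real.add_one_le_exp (z.re * x)
      nlinarith
    have e3 : x * (Real.exp (z.re * x))⁻¹ ≤ 1 / δ := by
      rw [← div_eq_mul_inv, div_le_div_iff₀ (Real.exp_pos _) hδ]
      linarith
    have : 0 ≤ R * Real.exp R := by positivity
    linarith

lemma hasDerivAt_integral_levyKernel {m : Measure ℝ}
    (hm : Integrable (fun x : ℝ => min 1 (x ^ 2)) m) (hpos : ∀ᵐ x ∂m, 0 < x)
    {z₀ : ℂ} (hz₀ : 0 < z₀.re) :
    HasDerivAt (fun z => ∫ x, levyKernel z x ∂m) (∫ x, levyKernelDeriv z₀ x ∂m) z₀ := by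
  have hre : ∀ z ∈ Metric.ball z₀ (z₀.re / 2), z₀.re / 2 ≤ z.re ∧ ‖z‖ ≤ ‖z₀‖ + z₀.re / 2 := by
    intro z hz
    have h1 : ‖z - z₀‖ < z₀.re / 2 := by simpa [dist_eq_norm] using hz
    have h2 := norm_sub_norm_le z z₀
    have h3 := Complex.abs_re_le_norm (z - z₀)
    rw [Complex.sub_re] at h3
    have h4 := abs_le.1 h3
    constructor <;> linarith [h4.1]
  refine (hasDerivAt_integral_of_dominated_loc_of_deriv_le
    (bound := fun x => (1 / (z₀.re / 2) + (‖z₀‖ + z₀.re / 2) * Real.exp (‖z₀‖ + z₀.re / 2)) *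
      min 1 (x ^ 2)) (Metric.ball_mem_nhds z₀ (half_pos hz₀)) ?_ ?_ ?_ ?_ ?_ ?_).2
  · exact Eventually.of_forall fun z => (measurable_levyKernel z).aestronglyMeasurable
  · exact integrable_levyKernel hm hpos hz₀.le
  · exact (measurable_levyKernelDeriv _).aestronglyMeasurable
  · filter_upwards [hpos] with x hx z hz
    exact norm_levyKernelDeriv_le (half_pos hz₀) (hre z hz).1 (hre z hz).2 hx
  · exact hm.const_mul _
  · refine Eventually.of_forall fun x z _ => ?_
    unfold levyKernel levyKernelDeriv
    have h1 : HasDerivAt (fun z : ℂ => -(z * (x : ℂ))) (-(x : ℂ)) z := by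
      simpa using ((hasDerivAt_id z).mul_const (x : ℂ)).fun_neg
    have h2 := (((hasDerivAt_id z).mul_const (x : ℂ)).mul_const (if x < 1 then (1:ℂ) else 0))
    have h3 := (h1.cexp.sub_const 1).add h2
    convert! h3 using 1
    simp
    ring

lemma laplaceC_eq (σ b : ℝ) (ν : Measure ℝ) (z : ℂ) :
    laplaceC σ b ν z = (σ : ℂ) ^ 2 * z ^ 2 - (b : ℂ) * z + ∫ x in Ioi (0:ℝ), levyKernel z x ∂ν :=
  rfl

lemma ae_restrict_Ioi_pos (ν : Measure ℝ) : ∀ᵐ x ∂(ν.restrict (Ioi (0:ℝ))), 0 < x :=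
  ae_restrict_mem measurableSet_Ioi

/-- The truncated second moment `σ² + ∫_{(0,1/r)} x² ν(dx)`. -/
def truncatedVariance (σ : ℝ) (ν : Measure ℝ) (r : ℝ) : ℝ :=
  σ ^ 2 + ∫ x in Ioi (0:ℝ), (Iio (1 / r)).indicator (fun x => x ^ 2) x ∂ν

lemma integrable_indicator_sq {ν : Measure ℝ}
    (hm : Integrable (fun x : ℝ => min 1 (x ^ 2)) (ν.restrict (Ioi 0))) {r : ℝ} (hr : 0 < r) :
    Integrable (fun x : ℝ => (Iio (1 / r)).indicator (fun x => x ^ 2) x) (ν.restrict (Ioi 0)) := by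
  refine integrable_of_norm_le_min_one_sq hm (ae_restrict_Ioi_pos ν) (C := 1 + (1 / r) ^ 2) ?_ ?_
  · exact (Measurable.indicator (by fun_prop) measurableSet_Iio).aestronglyMeasurable
  · intro x hx
    by_cases h : x < 1 / r
    · rw [indicator_of_mem (by exact h), Real.norm_of_nonneg (by positivity)]
      have h2 : x ^ 2 ≤ (1 / r) ^ 2 := by gcongr
      rcases le_total 1 (x ^ 2) with h1 | h1
      · rw [min_eq_left h1]; linarith
      · rw [min_eq_right h1]; nlinarith [sq_nonneg x, sq_nonneg (1 / r)]
    · rw [indicator_of_notMem (by exact h), norm_zero]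
      positivity

lemma integrable_sq_mul_exp {ν : Measure ℝ}
    (hm : Integrable (fun x : ℝ => min 1 (x ^ 2)) (ν.restrict (Ioi 0))) {l : ℝ} (hl : 0 < l) :
    Integrable (fun x : ℝ => x ^ 2 * Real.exp (-(l * x))) (ν.restrict (Ioi 0)) := by
  refine integrable_of_norm_le_min_one_sq hm (ae_restrict_Ioi_pos ν) (C := 1 + 2 / l ^ 2) ?_ ?_
  · exact Measurable.aestronglyMeasurable (by fun_prop)
  · intro x hx
    rw [Real.norm_of_nonneg (by positivity)]
    rcases le_total 1 (x ^ 2) with h1 | h1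
    · rw [min_eq_left h1, mul_one, Real.exp_neg, ← div_eq_mul_inv]
      have h2 := Real.quadratic_le_exp_of_nonneg (x := l * x) (by positivity)
      have h3 : x ^ 2 / Real.exp (l * x) ≤ 2 / l ^ 2 := by
        rw [div_le_div_iff₀ (Real.exp_pos _) (by positivity)]
        nlinarith [mul_pos hl hx]
      linarith
    · rw [min_eq_right h1]
      have : Real.exp (-(l * x)) ≤ 1 := Real.exp_le_one_iff.2 (by nlinarith)
      have h3 : 0 ≤ 2 / l ^ 2 := by positivity
      nlinarith [sq_nonneg x]

lemma re_levyKernel (s ξ x : ℝ) :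
    (levyKernel (s + ξ * Complex.I) x).re =
      Real.exp (-(s * x)) * Real.cos (ξ * x) - 1 + s * x * (if x < 1 then (1:ℝ) else 0) := by
  unfold levyKernel
  split_ifs with h <;> simp [Complex.exp_re]

lemma re_levyKernel_le {s ξ r x : ℝ} (hs : 0 ≤ s) (hr : 0 < r) (hsr : s ≤ r) (hξ : |ξ| ≤ r)
    (hx : 0 < x) :
    (levyKernel (s + ξ * Complex.I) x).re ≤ (levyKernel s x).re -
      2 / π ^ 2 * Real.exp (-1) * ξ ^ 2 * (Iio (1 / r)).indicator (fun x => x ^ 2) x := by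
  have h0 := re_levyKernel s 0 x
  simp only [Complex.ofReal_zero, zero_mul, add_zero, Real.cos_zero, mul_one] at h0
  rw [re_levyKernel, h0]
  by_cases h : x < 1 / r
  · rw [indicator_of_mem (by exact h)]
    have hrx : r * x < 1 := by rwa [lt_div_iff₀ hr, mul_comm] at h
    have hξx : |ξ * x| ≤ π := by
      rw [abs_mul, abs_of_pos hx]
      have := Real.pi_gt_three
      nlinarith
    have h1 := Real.cos_le_one_sub_mul_cos_sq hξx
    have h2 : Real.exp (-1) ≤ Real.exp (-(s * x)) := Real.exp_le_exp.2 (by nlinarith)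
    have h3 : 0 ≤ 2 / π ^ 2 * (ξ * x) ^ 2 := by positivity
    have h4 : Real.exp (-1) * (2 / π ^ 2 * (ξ * x) ^ 2) ≤
        Real.exp (-(s * x)) * (1 - Real.cos (ξ * x)) := by
      gcongr
      linarith
    nlinarith
  · rw [indicator_of_notMem (by exact h), mul_zero]
    have := Real.cos_le_one (ξ * x)
    have := Real.exp_pos (-(s * x))
    nlinarith

lemma re_laplaceC_le {σ b : ℝ} {ν : Measure ℝ}
    (hm : Integrable (fun x : ℝ => min 1 (x ^ 2)) (ν.restrict (Ioi 0)))
    {s ξ r : ℝ} (hs : 0 ≤ s) (hr : 0 < r) (hsr : s ≤ r) (hξ : |ξ| ≤ r) :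
    (laplaceC σ b ν (s + ξ * Complex.I)).re ≤ (laplaceC σ b ν s).re -
      2 / π ^ 2 * Real.exp (-1) * ξ ^ 2 * truncatedVariance σ ν r := by
  have hpos := ae_restrict_Ioi_pos ν
  have hi1 := integrable_levyKernel hm hpos (z := s + ξ * Complex.I) (by simpa using hs)
  have hi2 := integrable_levyKernel hm hpos (z := s) (by simpa using hs)
  have hi3 := (integrable_indicator_sq hm hr).const_mul (2 / π ^ 2 * Real.exp (-1) * ξ ^ 2)
  have key : (∫ x in Ioi (0:ℝ), levyKernel (s + ξ * Complex.I) x ∂ν).re ≤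
      (∫ x in Ioi (0:ℝ), levyKernel s x ∂ν).re - 2 / π ^ 2 * Real.exp (-1) * ξ ^ 2 *
        ∫ x in Ioi (0:ℝ), (Iio (1 / r)).indicator (fun x => x ^ 2) x ∂ν := by
    have e1 : ∀ z : ℂ, Integrable (levyKernel z) (ν.restrict (Ioi 0)) →
        (∫ x in Ioi (0:ℝ), levyKernel z x ∂ν).re =
        ∫ x in Ioi (0:ℝ), (levyKernel z x).re ∂ν := fun z hz => (integral_re hz).symm
    have hr1 : Integrable (fun x => (levyKernel (s + ξ * Complex.I) x).re)
      (ν.restrict (Ioi 0)) := hi1.re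
    have hr2 : Integrable (fun x => (levyKernel s x).re) (ν.restrict (Ioi 0)) := hi2.re
    rw [e1 _ hi1, e1 _ hi2, ← integral_const_mul, ← integral_sub hr2 hi3]
    refine integral_mono_ae hr1 (hr2.sub hi3) ?_
    filter_upwards [hpos] with x hx using re_levyKernel_le hs hr hsr hξ hx
  have hκ : 2 / π ^ 2 * Real.exp (-1) ≤ 1 := by
    have h1 : Real.exp (-1) ≤ 1 := Real.exp_le_one_iff.2 (by norm_num)
    have h2 : 2 / π ^ 2 ≤ 1 := by
      rw [div_le_one (by positivity)]
      nlinarith [Real.pi_gt_three]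
    exact mul_le_one₀ h2 (Real.exp_pos _).le h1
  have hre1 : ((σ : ℂ) ^ 2 * (s + ξ * Complex.I) ^ 2 - (b : ℂ) * (s + ξ * Complex.I)).re
      = σ ^ 2 * (s ^ 2 - ξ ^ 2) - b * s := by
    simp [pow_two, Complex.mul_re]
  have hre2 : ((σ : ℂ) ^ 2 * (s : ℂ) ^ 2 - (b : ℂ) * s).re = σ ^ 2 * s ^ 2 - b * s := by
    simp [pow_two, Complex.mul_re]
  rw [laplaceC_eq, laplaceC_eq, Complex.add_re, Complex.add_re, hre1, hre2, truncatedVariance]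
  have h5 : 2 / π ^ 2 * Real.exp (-1) * (ξ ^ 2 * σ ^ 2) ≤ 1 * (ξ ^ 2 * σ ^ 2) := by gcongr
  nlinarith

section Scaling

variable {σ : ℝ} {ν : Measure ℝ} {f : ℝ → ℝ} {α c x₀ : ℝ}

lemma exists_truncatedVariance_ge
    (hm : Integrable (fun x : ℝ => min 1 (x ^ 2)) (ν.restrict (Ioi 0)))
    (hf : ∀ l : ℝ, 0 < l → f l = 2 * σ ^ 2 + ∫ x in Ioi (0:ℝ), x ^ 2 * Real.exp (-(l * x)) ∂ν)
    (hc : 0 < c) (hx₀ : 0 ≤ x₀) (hscal : WLSC f (α - 2) c x₀) :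
    ∃ a : ℝ, 0 < a ∧ ∀ r, x₀ < r → a * f r ≤ truncatedVariance σ ν r := by
  have hlim := tendsto_rpow_mul_exp_neg_mul_atTop_nhds_zero (2 - α) 1 one_pos
  have hev := hlim.eventually (gt_mem_nhds (show 0 < c / (2 * Real.exp 1) by positivity))
  obtain ⟨l, hl, hl1⟩ := (hev.and (eventually_ge_atTop 1)).exists
  have hl0 : 0 < l := by linarith
  have hle : 2 * Real.exp (-(l - 1)) ≤ c * l ^ (α - 2) := by
    have e1 : l ^ (2 - α) = (l ^ (α - 2))⁻¹ := by rw [← Real.rpow_neg hl0.le]; congr 1; ring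
    have e2 : Real.exp (-(l - 1)) = Real.exp (-1 * l) * Real.exp 1 := by
      rw [← Real.exp_add]; congr 1; ring
    have hp : 0 < l ^ (α - 2) := Real.rpow_pos_of_pos hl0 _
    rw [e1, inv_mul_eq_div, div_lt_div_iff₀ hp (by positivity)] at hl
    rw [e2]; linarith
  refine ⟨c * l ^ (α - 2) / 4, by positivity, fun r hr => ?_⟩
  have hr0 : 0 < r := hx₀.trans_lt hr
  have h1 := hscal l hl1 r hr
  have hi1 := integrable_sq_mul_exp hm hr0
  have hi2 := integrable_sq_mul_exp hm (mul_pos hl0 hr0)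
  have hi3 := integrable_indicator_sq hm hr0
  have h2 : ∫ x in Ioi (0:ℝ), x ^ 2 * Real.exp (-(l * r * x)) ∂ν ≤
      (∫ x in Ioi (0:ℝ), (Iio (1 / r)).indicator (fun x => x ^ 2) x ∂ν) +
      Real.exp (-(l - 1)) * ∫ x in Ioi (0:ℝ), x ^ 2 * Real.exp (-(r * x)) ∂ν := by
    rw [← integral_const_mul, ← integral_add hi3 (hi1.const_mul _)]
    refine integral_mono_ae hi2 (hi3.add (hi1.const_mul _)) ?_
    filter_upwards [ae_restrict_Ioi_pos ν] with x hx
    by_cases h : x < 1 / r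
    · rw [indicator_of_mem (by exact h)]
      have : Real.exp (-(l * r * x)) ≤ 1 := Real.exp_le_one_iff.2 (by
        have : 0 < l * r * x := by positivity
        linarith)
      have h3 : 0 ≤ Real.exp (-(l - 1)) * (x ^ 2 * Real.exp (-(r * x))) := by positivity
      nlinarith [sq_nonneg x]
    · rw [indicator_of_notMem (by exact h), zero_add]
      have hrx : 1 ≤ r * x := by
        rw [not_lt, div_le_iff₀ hr0] at h; linarith
      have : Real.exp (-(l * r * x)) ≤ Real.exp (-(l - 1)) * Real.exp (-(r * x)) := by
        rw [← Real.exp_add]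
        apply Real.exp_le_exp.2
        nlinarith
      nlinarith [sq_nonneg x]
  have h0 : 0 ≤ ∫ x in Ioi (0:ℝ), (Iio (1 / r)).indicator (fun x => x ^ 2) x ∂ν :=
    integral_nonneg fun x => indicator_nonneg (fun x _ => sq_nonneg x) x
  have h0' : 0 ≤ ∫ x in Ioi (0:ℝ), x ^ 2 * Real.exp (-(r * x)) ∂ν :=
    integral_nonneg fun x => by positivity
  rw [hf _ (mul_pos hl0 hr0)] at h1
  have hfr : 0 ≤ f r := by rw [hf r hr0]; positivity
  have h5 : Real.exp (-(l - 1)) * (∫ x in Ioi (0:ℝ), x ^ 2 * Real.exp (-(r * x)) ∂ν) ≤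
      Real.exp (-(l - 1)) * f r := by
    gcongr
    rw [hf r hr0]; nlinarith [sq_nonneg σ]
  have h6 : Real.exp (-(l - 1)) * f r ≤ c * l ^ (α - 2) / 2 * f r := by
    gcongr; linarith
  rw [truncatedVariance]
  linarith

lemma pos_of_unbounded_variation
    (hm : Integrable (fun x : ℝ => min 1 (x ^ 2)) (ν.restrict (Ioi 0)))
    (hf : ∀ l : ℝ, 0 < l → f l = 2 * σ ^ 2 + ∫ x in Ioi (0:ℝ), x ^ 2 * Real.exp (-(l * x)) ∂ν)
    (hUV : 0 < σ ∨ ∫⁻ x in Ioo (0:ℝ) 1, ENNReal.ofReal x ∂ν = ⊤) {l : ℝ} (hl : 0 < l) :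
    0 < f l := by
  rw [hf l hl]
  have h0 : 0 ≤ ∫ x in Ioi (0:ℝ), x ^ 2 * Real.exp (-(l * x)) ∂ν :=
    integral_nonneg fun x => by positivity
  rcases hUV with h | h
  · positivity
  · suffices 0 < ∫ x in Ioi (0:ℝ), x ^ 2 * Real.exp (-(l * x)) ∂ν by positivity
    refine lt_of_le_of_ne h0 fun hzero => ?_
    have hae := (integral_eq_zero_iff_of_nonneg (fun x => by positivity)
      (integrable_sq_mul_exp hm hl)).1 hzero.symm
    have hF : ∀ᵐ x ∂(ν.restrict (Ioi (0:ℝ))), False := by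
      filter_upwards [hae, ae_restrict_Ioi_pos ν] with x h1 h2
      have : 0 < x ^ 2 * Real.exp (-(l * x)) := by positivity
      exact this.ne' h1
    have hr0 : ν.restrict (Ioi (0:ℝ)) = 0 := by
      rw [← ae_eq_bot]; exact Filter.eventually_false_iff_eq_bot.1 hF
    have : ν.restrict (Ioo (0:ℝ) 1) = 0 := by
      rw [Measure.restrict_eq_zero] at hr0 ⊢
      exact measure_mono_null Ioo_subset_Ioi_self hr0
    rw [this] at h
    simp at h

lemma antitone_of_laplace
    (hm : Integrable (fun x : ℝ => min 1 (x ^ 2)) (ν.restrict (Ioi 0)))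
    (hf : ∀ l : ℝ, 0 < l → f l = 2 * σ ^ 2 + ∫ x in Ioi (0:ℝ), x ^ 2 * Real.exp (-(l * x)) ∂ν)
    {u v : ℝ} (hu : 0 < u) (huv : u ≤ v) : f v ≤ f u := by
  have hv : 0 < v := by linarith
  rw [hf u hu, hf v hv]
  gcongr 2 * σ ^ 2 + ?_
  refine integral_mono_ae (integrable_sq_mul_exp hm hv) (integrable_sq_mul_exp hm hu) ?_
  filter_upwards [ae_restrict_Ioi_pos ν] with x hx
  gcongr

lemma exists_doubling
    (hm : Integrable (fun x : ℝ => min 1 (x ^ 2)) (ν.restrict (Ioi 0)))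
    (hf : ∀ l : ℝ, 0 < l → f l = 2 * σ ^ 2 + ∫ x in Ioi (0:ℝ), x ^ 2 * Real.exp (-(l * x)) ∂ν)
    (hfpos : ∀ l : ℝ, 0 < l → 0 < f l)
    (hc : 0 < c) (hx₀ : 0 ≤ x₀) (hscal : WLSC f (α - 2) c x₀) :
    ∃ D : ℝ, 0 < D ∧ ∀ w, x₀ < w → f (w / 2) ≤ D * f w := by
  have hp : 0 < c * 2 ^ (α - 2) := mul_pos hc (Real.rpow_pos_of_pos two_pos _)
  have hbig : ∀ w, 2 * x₀ < w → f (w / 2) ≤ (c * 2 ^ (α - 2))⁻¹ * f w := by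
    intro w hw
    have h := hscal 2 one_le_two (w / 2) (by linarith)
    rw [mul_div_cancel₀ w two_ne_zero] at h
    rw [inv_mul_eq_div, le_div_iff₀ hp]
    linarith
  rcases hx₀.eq_or_lt with h0 | h0
  · refine ⟨_, inv_pos.2 hp, fun w hw => hbig w (by linarith)⟩
  · have h1 := hfpos (x₀ / 2) (by linarith)
    have h2 := hfpos (2 * x₀) (by linarith)
    refine ⟨(c * 2 ^ (α - 2))⁻¹ + f (x₀ / 2) / f (2 * x₀),
      by positivity, fun w hw => ?_⟩
    have hfw := hfpos w (by linarith)
    rcases le_or_gt w (2 * x₀) with h | h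
    · have e1 := antitone_of_laplace hm hf (by linarith : 0 < x₀ / 2)
        (by linarith : x₀ / 2 ≤ w / 2)
      have e2 := antitone_of_laplace hm hf (by linarith : 0 < w) h
      have e3 : f (x₀ / 2) ≤ f (x₀ / 2) / f (2 * x₀) * f w := by
        rw [div_mul_eq_mul_div, le_div_iff₀ h2]
        gcongr
      have : 0 ≤ (c * 2 ^ (α - 2))⁻¹ * f w := by positivity
      linarith
    · have e1 := hbig w h
      have : 0 ≤ f (x₀ / 2) / f (2 * x₀) * f w := by positivity
      linarith

end Scaling

lemma integrable_exp_neg_mul_abs_rpow {B α : ℝ} (hB : 0 < B) (hα : 0 < α) :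
    Integrable (fun u : ℝ => Real.exp (-(B * |u| ^ α))) := by
  have h := integrableOn_rpow_mul_exp_neg_mul_rpow (s := 0) (by norm_num) hα hB
  have hcont : Continuous (fun u : ℝ => Real.exp (-(B * |u| ^ α))) := by
    have : Continuous fun u : ℝ => |u| ^ α := continuous_abs.rpow_const fun _ => Or.inr hα.le
    fun_prop
  refine hcont.locallyIntegrable.integrable_of_isBigO_atTop_of_norm_isNegInvariant
    (g := fun x : ℝ => x ^ (0:ℝ) * Real.exp (-B * x ^ α)) ?_ ?_ ⟨Ioi 0, Ioi_mem_atTop 0, h⟩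
  · exact Eventually.of_forall fun x => by simp
  · refine EventuallyEq.isBigO ?_
    filter_upwards [eventually_ge_atTop 0] with x hx
    simp [abs_of_nonneg hx]

lemma tendsto_exp_neg_mul_abs_rpow_cocompact {B α : ℝ} (hB : 0 < B) (hα : 0 < α) :
    Tendsto (fun u : ℝ => Real.exp (-(B * |u| ^ α))) (cocompact ℝ) (nhds 0) := by
  have h1 : Tendsto (fun u : ℝ => |u|) (cocompact ℝ) atTop := tendsto_norm_cocompact_atTop
  exact Real.tendsto_exp_neg_atTop_nhds_zero.comp
    (((tendsto_rpow_atTop hα).comp h1).const_mul_atTop hB)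

lemma Continuous.integrable_of_norm_le_off_compact {F : ℝ → ℂ} (hF : Continuous F) {g : ℝ → ℝ}
    (hg : Integrable g) {X : ℝ} (hle : ∀ ξ, X ≤ |ξ| → ‖F ξ‖ ≤ g ξ) : Integrable F := by
  refine hF.locallyIntegrable.integrable_of_isBigO_cocompact (g := g) ?_ (hg.integrableAtFilter _)
  refine Asymptotics.IsBigO.of_bound 1 ?_
  have h1 : Tendsto (fun u : ℝ => |u|) (cocompact ℝ) atTop := tendsto_norm_cocompact_atTop
  filter_upwards [h1.eventually_ge_atTop X] with ξ hξ
  rw [one_mul]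
  exact (hle ξ hξ).trans (le_abs_self _)

lemma integrable_vertical_line {G : ℂ → ℂ} (hc : ContinuousOn G {z : ℂ | 0 ≤ z.re}) {g : ℝ → ℝ}
    (hg : Integrable g) {X s : ℝ} (hs : 0 ≤ s)
    (hle : ∀ ξ : ℝ, X ≤ |ξ| → ‖G (s + ξ * Complex.I)‖ ≤ g ξ) :
    Integrable (fun ξ : ℝ => G (s + ξ * Complex.I)) := by
  refine Continuous.integrable_of_norm_le_off_compact ?_ hg hle
  exact hc.comp_continuous (by fun_prop) fun ξ => by simpa using hs

/-- Shifting a vertical contour of integration from the imaginary axis into the right half-plane. -/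
lemma integral_vertical_line_eq {G : ℂ → ℂ} (hc : ContinuousOn G {z : ℂ | 0 ≤ z.re})
    (hd : ∀ z : ℂ, 0 < z.re → DifferentiableAt ℂ G z) {g : ℝ → ℝ} (hg : Integrable g)
    (hg0 : Tendsto g (cocompact ℝ) (nhds 0)) {X w : ℝ} (hw : 0 < w)
    (hle : ∀ s ∈ Icc (0:ℝ) w, ∀ ξ : ℝ, X ≤ |ξ| → ‖G (s + ξ * Complex.I)‖ ≤ g ξ) :
    ∫ ξ : ℝ, G (ξ * Complex.I) = ∫ ξ : ℝ, G (w + ξ * Complex.I) := by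
  have hi0 := integrable_vertical_line hc hg le_rfl (hle 0 ⟨le_rfl, hw.le⟩)
  have hiw := integrable_vertical_line hc hg hw.le (hle w ⟨hw.le, le_rfl⟩)
  simp only [Complex.ofReal_zero, zero_add] at hi0
  have hside : ∀ r : ℝ → ℝ, Tendsto r atTop (cocompact ℝ) →
      Tendsto (fun R => ∫ x in (0:ℝ)..w, G (x + r R * Complex.I)) atTop (nhds 0) := by
    intro r hr
    have h1 : Tendsto (fun u : ℝ => |u|) (cocompact ℝ) atTop := tendsto_norm_cocompact_atTop
    have h2 : Tendsto (fun R => g (r R) * |w - 0|) atTop (nhds 0) := by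
      simpa using (hg0.comp hr).mul_const (|w - 0|)
    refine squeeze_zero_norm' ?_ h2
    filter_upwards [(h1.comp hr).eventually_ge_atTop X] with R hR
    refine intervalIntegral.norm_integral_le_of_norm_le_const fun x hx => ?_
    rw [uIoc_of_le hw.le] at hx
    exact hle x ⟨hx.1.le, hx.2⟩ _ hR
  have hrect : ∀ R : ℝ, 0 ≤ R →
      (∫ x in (0:ℝ)..w, G (x + (-R : ℝ) * Complex.I)) - (∫ x in (0:ℝ)..w, G (x + R * Complex.I)) +
      Complex.I • (∫ y in (-R)..R, G (w + y * Complex.I)) -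
      Complex.I • (∫ y in (-R)..R, G (y * Complex.I)) = 0 := by
    intro R hR
    have h := Complex.integral_boundary_rect_eq_zero_of_continuousOn_of_differentiableOn G
      (⟨0, -R⟩ : ℂ) (⟨w, R⟩ : ℂ) ?_ ?_
    · simpa using h
    · refine hc.mono fun z hz => ?_
      have := (Complex.mem_reProdIm.1 hz).1
      simp only [uIcc_of_le hw.le] at this
      exact this.1
    · intro z hz
      have := (Complex.mem_reProdIm.1 hz).1
      simp only [min_eq_left hw.le] at this
      exact (hd z this.1).differentiableWithinAt
  have hneg : Tendsto (fun R : ℝ => -R) atTop (cocompact ℝ) :=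
    tendsto_neg_atTop_atBot.mono_right atBot_le_cocompact
  have hid : Tendsto (fun R : ℝ => R) atTop (cocompact ℝ) := atTop_le_cocompact
  have l1 := intervalIntegral_tendsto_integral hiw tendsto_neg_atTop_atBot tendsto_id
  have l0 := intervalIntegral_tendsto_integral hi0 tendsto_neg_atTop_atBot tendsto_id
  have lim := (((hside _ hneg).sub (hside _ hid)).add (l1.const_smul Complex.I)).sub
    (l0.const_smul Complex.I)
  have lim0 : Tendsto (fun _ : ℝ => (0:ℂ)) atTop (nhds 0) := tendsto_const_nhds
  have heq := tendsto_nhds_unique (lim.congr' (by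
    filter_upwards [eventually_ge_atTop 0] with R hR using hrect R hR)) lim0
  simp only [sub_zero, zero_add, smul_eq_mul, ← mul_sub, mul_eq_zero, Complex.I_ne_zero,
    false_or, sub_eq_zero] at heq
  exact heq.symm

open scoped FourierTransform SchwartzMap in
/-- Parseval's identity for a finite measure with integrable characteristic function. -/
lemma integral_schwartz_eq_of_char {μ : Measure ℝ} [IsFiniteMeasure μ] {ρ : ℝ → ℂ}
    (hchar : ∀ ξ : ℝ, ∫ x : ℝ, Complex.exp (Complex.I * (ξ : ℂ) * (x : ℂ)) ∂μ = ρ ξ)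
    (hρ : Integrable ρ) (f : 𝓢(ℝ, ℂ)) :
    ∫ x, f x ∂μ = ∫ x, f x * (1 / (2 * π) * ∫ ξ : ℝ, Complex.exp (-(Complex.I * ξ * x)) * ρ ξ) := by
  set g : 𝓢(ℝ, ℂ) := 𝓕⁻ f with hg
  have hπ := Real.pi_pos
  have hρ2 : Integrable (fun s : ℝ => ρ (-(2 * π) * s)) :=
    hρ.comp_mul_left' (by linarith [hπ] |> ne_of_lt)
  have hL : Continuous fun p : ℝ × ℝ => (innerₗ ℝ) p.1 p.2 := continuous_inner
  have h1 := VectorFourier.integral_fourierIntegral_smul_eq_flip (μ := μ) (ν := volume)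
    (L := innerₗ ℝ) (f := fun _ => (1:ℂ)) (g := g)
    Real.continuous_fourierChar hL (integrable_const _) g.integrable
  have h2 := VectorFourier.integral_fourierIntegral_smul_eq_flip (μ := volume) (ν := volume)
    (L := -innerₗ ℝ) (f := f) (g := fun s : ℝ => ρ (-(2 * π) * s))
    Real.continuous_fourierChar hL.neg f.integrable hρ2
  have e1 : ∀ ξ, VectorFourier.fourierIntegral 𝐞 μ (innerₗ ℝ) (fun _ => (1:ℂ)) ξ =
      ρ (-(2 * π) * ξ) := by
    intro ξ
    rw [← hchar, VectorFourier.fourierIntegral]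
    refine integral_congr_ae (Eventually.of_forall fun x => ?_)
    simp only [Circle.smul_def, Real.fourierChar_apply, smul_eq_mul, mul_one]
    congr 1
    simp
    ring
  have e2 : ∀ x, VectorFourier.fourierIntegral 𝐞 volume (innerₗ ℝ).flip g x = f x := by
    intro x
    have : 𝓕 (g : ℝ → ℂ) x = f x := by
      rw [← SchwartzMap.fourier_coe, hg, FourierTransform.fourier_fourierInv_eq]
    rw [← this, flip_innerₗ]
    rfl
  have e3 : ∀ ξ, VectorFourier.fourierIntegral 𝐞 volume (-innerₗ ℝ) f ξ = g ξ := by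
    intro ξ
    rw [hg, SchwartzMap.fourierInv_coe]
    rfl
  have e4 : ∀ x, VectorFourier.fourierIntegral 𝐞 volume (-innerₗ ℝ).flip
      (fun s : ℝ => ρ (-(2 * π) * s)) x =
      1 / (2 * π) * ∫ ξ : ℝ, Complex.exp (-(Complex.I * ξ * x)) * ρ ξ := by
    intro x
    have h := Measure.integral_comp_mul_left
      (fun ξ : ℝ => Complex.exp (-(Complex.I * ξ * x)) * ρ ξ) (-(2 * π))
    have habs : |(-(2 * π))⁻¹| = 1 / (2 * π) := by
      rw [abs_inv, abs_neg, abs_of_pos (by positivity), one_div]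
    rw [habs, Complex.real_smul] at h
    push_cast at h
    rw [← h, VectorFourier.fourierIntegral]
    refine integral_congr_ae (Eventually.of_forall fun s => ?_)
    simp only [Circle.smul_def, Real.fourierChar_apply, smul_eq_mul]
    congr 2
    simp
    ring
  simp only [e1, e2, smul_eq_mul, one_mul] at h1
  simp only [e3, e4, smul_eq_mul] at h2
  rw [← h1, ← h2]
  exact integral_congr_ae (Eventually.of_forall fun s => mul_comm _ _)

/-- Fourier inversion: the density attached to an integrable characteristic function. -/
def fourierDensity (ρ : ℝ → ℂ) (x : ℝ) : ℝ :=
  1 / (2 * π) * (∫ ξ : ℝ, Complex.exp (-(Complex.I * ξ * x)) * ρ ξ).re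

lemma continuous_integral_cexp_mul {ρ : ℝ → ℂ} (hρ : Integrable ρ) :
    Continuous fun x : ℝ => ∫ ξ : ℝ, Complex.exp (-(Complex.I * ξ * x)) * ρ ξ := by
  refine continuous_of_dominated (bound := fun ξ => ‖ρ ξ‖) ?_ ?_ hρ.norm ?_
  · intro x
    have : Continuous fun ξ : ℝ => Complex.exp (-(Complex.I * ξ * x)) := by fun_prop
    exact this.aestronglyMeasurable.mul hρ.aestronglyMeasurable
  · intro x
    refine Eventually.of_forall fun ξ => ?_
    rw [norm_mul, Complex.norm_exp]
    simp
  · exact Eventually.of_forall fun ξ => by fun_prop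

lemma continuous_fourierDensity {ρ : ℝ → ℂ} (hρ : Integrable ρ) :
    Continuous (fourierDensity ρ) :=
  continuous_const.mul (Complex.continuous_re.comp (continuous_integral_cexp_mul hρ))

lemma integral_smooth_eq_of_char {μ : Measure ℝ} [IsFiniteMeasure μ] {ρ : ℝ → ℂ}
    (hchar : ∀ ξ : ℝ, ∫ x : ℝ, Complex.exp (Complex.I * (ξ : ℂ) * (x : ℂ)) ∂μ = ρ ξ)
    (hρ : Integrable ρ) {f : ℝ → ℝ} (hf : ContDiff ℝ (⊤ : ℕ∞) f) (hsupp : HasCompactSupport f) :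
    ∫ x, f x ∂μ = ∫ x, f x * fourierDensity ρ x := by
  have hF : ContDiff ℝ (⊤ : ℕ∞) (fun x => (f x : ℂ)) := Complex.ofRealCLM.contDiff.comp hf
  have hS : HasCompactSupport (fun x => (f x : ℂ)) := hsupp.comp_left Complex.ofReal_zero
  have h := integral_schwartz_eq_of_char hchar hρ (hS.toSchwartzMap hF)
  have e : ∀ x, (hS.toSchwartzMap hF) x = (f x : ℂ) := fun x => rfl
  simp only [e] at h
  have h' := congrArg Complex.re h
  rw [integral_complex_ofReal, Complex.ofReal_re] at h'
  have hint : Integrable (fun x : ℝ => (f x : ℂ) *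
      (1 / (2 * π) * ∫ ξ : ℝ, Complex.exp (-(Complex.I * ξ * x)) * ρ ξ)) :=
    (hF.continuous.mul (continuous_const.mul
      (continuous_integral_cexp_mul hρ))).integrable_of_hasCompactSupport hS.mul_right
  rw [h', show ∀ z : ℂ, z.re = RCLike.re z from fun _ => rfl, ← integral_re hint]
  refine integral_congr_ae (Eventually.of_forall fun x => ?_)
  have hc : (1 / (2 * π) : ℂ) = ((1 / (2 * π) : ℝ) : ℂ) := by push_cast; ring
  simp only [RCLike.re_to_complex]
  rw [hc, Complex.re_ofReal_mul, Complex.re_ofReal_mul, fourierDensity]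

/-- Smooth bumps increasing to the indicator of a ball. -/
def ballBump (x₀ : ℝ) {r : ℝ} (hr : 0 < r) (n : ℕ) : ContDiffBump x₀ where
  rIn := r * (1 - 1 / (n + 2))
  rOut := r
  rIn_pos := by
    refine mul_pos hr ?_
    rw [sub_pos, div_lt_one (by positivity)]
    have : (0:ℝ) ≤ n := n.cast_nonneg
    linarith
  rIn_lt_rOut := by
    have : (0:ℝ) < 1 / ((n:ℝ) + 2) := by positivity
    nlinarith

lemma tendsto_ballBump (x₀ : ℝ) {r : ℝ} (hr : 0 < r) (x : ℝ) :
    Tendsto (fun n => ballBump x₀ hr n x) atTop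
      (nhds ((Metric.ball x₀ r).indicator (fun _ => (1:ℝ)) x)) := by
  by_cases hx : x ∈ Metric.ball x₀ r
  · rw [indicator_of_mem hx]
    have hlim : Tendsto (fun n : ℕ => r * (1 - 1 / ((n:ℝ) + 2))) atTop (nhds r) := by
      have h0 : Tendsto (fun n : ℕ => (n:ℝ) + 2) atTop atTop :=
        tendsto_natCast_atTop_atTop.atTop_add tendsto_const_nhds
      have h1 : Tendsto (fun n : ℕ => 1 / ((n:ℝ) + 2)) atTop (nhds 0) := by
        simp only [one_div]
        exact h0.inv_tendsto_atTop
      simpa using (h1.const_sub 1).const_mul r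
    refine tendsto_const_nhds.congr' ?_
    filter_upwards [hlim.eventually (lt_mem_nhds (Metric.mem_ball.1 hx))] with n hn
    exact ((ballBump x₀ hr n).one_of_mem_closedBall (Metric.mem_closedBall.2 hn.le)).symm
  · rw [indicator_of_notMem hx]
    refine tendsto_const_nhds.congr fun n => ?_
    exact ((ballBump x₀ hr n).zero_of_le_dist (not_lt.1 hx)).symm

lemma norm_ballBump_le (x₀ : ℝ) {r : ℝ} (hr : 0 < r) (n : ℕ) (x : ℝ) :
    ‖ballBump x₀ hr n x‖ ≤ (Metric.ball x₀ r).indicator (fun _ => (1:ℝ)) x := by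
  rw [Real.norm_of_nonneg (ballBump x₀ hr n).nonneg]
  by_cases hx : x ∈ Metric.ball x₀ r
  · rw [indicator_of_mem hx]; exact (ballBump x₀ hr n).le_one
  · rw [indicator_of_notMem hx]
    exact ((ballBump x₀ hr n).zero_of_le_dist (not_lt.1 hx)).le

lemma measureReal_ball_eq_of_char {μ : Measure ℝ} [IsFiniteMeasure μ] {ρ : ℝ → ℂ}
    (hchar : ∀ ξ : ℝ, ∫ x : ℝ, Complex.exp (Complex.I * (ξ : ℂ) * (x : ℂ)) ∂μ = ρ ξ)
    (hρ : Integrable ρ) (x₀ : ℝ) {r : ℝ} (hr : 0 < r) :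
    μ.real (Metric.ball x₀ r) = ∫ x in Metric.ball x₀ r, fourierDensity ρ x := by
  have hd := continuous_fourierDensity hρ
  have hmeas : MeasurableSet (Metric.ball x₀ r) := Metric.isOpen_ball.measurableSet
  have hcont : ∀ n, Continuous (ballBump x₀ hr n) := fun n => (ballBump x₀ hr n).continuous
  have l1 : Tendsto (fun n => ∫ x, ballBump x₀ hr n x ∂μ) atTop
      (nhds (∫ x, (Metric.ball x₀ r).indicator (fun _ => (1:ℝ)) x ∂μ)) := by
    refine tendsto_integral_of_dominated_convergence _ (fun n => (hcont n).aestronglyMeasurable)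
      ((integrable_const (1:ℝ)).indicator hmeas)
      (fun n => Eventually.of_forall (norm_ballBump_le x₀ hr n))
      (Eventually.of_forall (tendsto_ballBump x₀ hr))
  have hid : IntegrableOn (fourierDensity ρ) (Metric.ball x₀ r) :=
    (hd.continuousOn.integrableOn_compact (isCompact_closedBall _ _)).mono_set Metric.ball_subset_closedBall
  have l2 : Tendsto (fun n => ∫ x, ballBump x₀ hr n x * fourierDensity ρ x) atTop
      (nhds (∫ x, (Metric.ball x₀ r).indicator (fun _ => (1:ℝ)) x * fourierDensity ρ x)) := by
    refine tendsto_integral_of_dominated_convergence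
      (fun x => (Metric.ball x₀ r).indicator (fun x => ‖fourierDensity ρ x‖) x)
      (fun n => ((hcont n).mul hd).aestronglyMeasurable)
      (IntegrableOn.integrable_indicator hid.norm hmeas) (fun n => Eventually.of_forall fun x => ?_)
      (Eventually.of_forall fun x => (tendsto_ballBump x₀ hr x).mul_const _)
    rw [norm_mul]
    have := norm_ballBump_le x₀ hr n x
    by_cases hx : x ∈ Metric.ball x₀ r
    · rw [indicator_of_mem hx] at this ⊢
      exact mul_le_of_le_one_left (norm_nonneg _) this
    · rw [indicator_of_notMem hx] at this ⊢
      exact mul_nonpos_of_nonpos_of_nonneg this (norm_nonneg _)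
  have heq := tendsto_nhds_unique (l1.congr fun n => integral_smooth_eq_of_char hchar hρ
    (ballBump x₀ hr n).contDiff (ballBump x₀ hr n).hasCompactSupport) l2
  rw [integral_indicator_const _ hmeas, smul_eq_mul, mul_one] at heq
  rw [heq, ← integral_indicator hmeas]
  refine integral_congr_ae (Eventually.of_forall fun x => ?_)
  by_cases hx : x ∈ Metric.ball x₀ r
  · simp [indicator_of_mem hx]
  · simp [indicator_of_notMem hx]

lemma fourierDensity_nonneg {μ : Measure ℝ} [IsFiniteMeasure μ] {ρ : ℝ → ℂ}
    (hchar : ∀ ξ : ℝ, ∫ x : ℝ, Complex.exp (Complex.I * (ξ : ℂ) * (x : ℂ)) ∂μ = ρ ξ)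
    (hρ : Integrable ρ) (x₀ : ℝ) : 0 ≤ fourierDensity ρ x₀ := by
  by_contra! hneg
  have hd := continuous_fourierDensity hρ
  have hev := hd.continuousAt.eventually (gt_mem_nhds (show fourierDensity ρ x₀ <
    fourierDensity ρ x₀ / 2 by linarith))
  obtain ⟨r, hr, hball⟩ := Metric.eventually_nhds_iff_ball.1 hev
  have hid : IntegrableOn (fourierDensity ρ) (Metric.ball x₀ r) :=
    (hd.continuousOn.integrableOn_compact (isCompact_closedBall _ _)).mono_set Metric.ball_subset_closedBall
  have h1 := measureReal_ball_eq_of_char hchar hρ x₀ hr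
  have h2 : ∫ x in Metric.ball x₀ r, fourierDensity ρ x ≤
      ∫ x in Metric.ball x₀ r, fourierDensity ρ x₀ / 2 :=
    setIntegral_mono_on hid (integrableOn_const (by finiteness)) Metric.isOpen_ball.measurableSet
      fun x hx => (hball x hx).le
  rw [setIntegral_const, Measure.real, Real.volume_ball, smul_eq_mul,
    ENNReal.toReal_ofReal (by linarith)] at h2
  have h3 : 0 ≤ μ.real (Metric.ball x₀ r) := measureReal_nonneg
  nlinarith

/-- A finite measure with integrable characteristic function has density `fourierDensity`. -/
theorem eq_withDensity_fourierDensity {μ : Measure ℝ} [IsFiniteMeasure μ] {ρ : ℝ → ℂ}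
    (hchar : ∀ ξ : ℝ, ∫ x : ℝ, Complex.exp (Complex.I * (ξ : ℂ) * (x : ℂ)) ∂μ = ρ ξ)
    (hρ : Integrable ρ) :
    μ = volume.withDensity (fun x => ENNReal.ofReal (fourierDensity ρ x)) := by
  have hd := continuous_fourierDensity hρ
  refine Real.measure_ext_Ioo_rat fun p q => ?_
  rcases le_or_gt (q : ℝ) p with h | h
  · simp [Ioo_eq_empty_of_le h]
  · have hr : 0 < ((q : ℝ) - p) / 2 := by linarith
    rw [Real.Ioo_eq_ball, withDensity_apply _ Metric.isOpen_ball.measurableSet,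
      ← ofReal_integral_eq_lintegral_ofReal
        ((hd.continuousOn.integrableOn_compact (isCompact_closedBall _ _)).mono_set Metric.ball_subset_closedBall)
        (Eventually.of_forall (fourierDensity_nonneg hchar hρ)),
      ← measureReal_ball_eq_of_char hchar hρ _ hr, ofReal_measureReal]

lemma WLSC.mono_exponent {f : ℝ → ℝ} {τ τ' c x₀ : ℝ} (h : WLSC f τ c x₀) (hτ : τ' ≤ τ)
    (hc : 0 ≤ c) (hf : ∀ x, x₀ < x → 0 ≤ f x) : WLSC f τ' c x₀ := by
  intro l hl x hx
  have := hf x hx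
  refine le_trans ?_ (h l hl x hx)
  gcongr

lemma WLSC.sq_mul_ge {f : ℝ → ℝ} {α c x₀ x y : ℝ} (h : WLSC f (α - 2) c x₀) (hx₀ : x₀ < x)
    (hx : 0 < x) (hxy : x ≤ y) : c * (y / x) ^ α * (x ^ 2 * f x) ≤ y ^ 2 * f y := by
  have hy : 0 < y := hx.trans_le hxy
  have h1 := h (y / x) ((one_le_div hx).2 hxy) x hx₀
  rw [div_mul_cancel₀ y hx.ne', Real.rpow_sub (by positivity), Real.rpow_two] at h1
  calc _ = y ^ 2 * (c * ((y / x) ^ α / (y / x) ^ 2) * f x) := by field_simp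
    _ ≤ _ := by gcongr

section Saddle

open Topology

variable {f : ℝ → ℝ} {Θ : ℝ → ℝ → ℂ} {α c x₀ A E : ℝ}

/-- Pairs `(t, w)` with `t > 0`, `w > x₀`, as `t w² f(w) → ∞`. -/
def saddleFilter (f : ℝ → ℝ) (x₀ : ℝ) : Filter (ℝ × ℝ) :=
  comap (fun p => p.1 * p.2 ^ 2 * f p.2) atTop ⊓ 𝓟 {p | 0 < p.1 ∧ x₀ < p.2}

instance : (saddleFilter f x₀).IsCountablyGenerated := by
  unfold saddleFilter; infer_instance

lemma tendsto_saddleFilter :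
    Tendsto (fun p : ℝ × ℝ => p.1 * p.2 ^ 2 * f p.2) (saddleFilter f x₀) atTop :=
  tendsto_comap.mono_left inf_le_left

lemma eventually_saddleFilter_mem : ∀ᶠ p in saddleFilter f x₀, 0 < p.1 ∧ x₀ < p.2 :=
  mem_inf_of_right (mem_principal_self _)

lemma norm_cexp_saddle_le (hA : 0 < A) (hα2 : α ≤ 2) (hc : 0 < c) (hx₀ : 0 ≤ x₀)
    (hfpos : ∀ l : ℝ, 0 < l → 0 < f l) (hscal : WLSC f (α - 2) c x₀)
    (hre : ∀ w ξ r, x₀ < w → w ≤ r → |ξ| ≤ r → (Θ w ξ).re ≤ -(A * (ξ ^ 2 * f r)))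
    {t w : ℝ} (ht : 0 < t) (hw : x₀ < w) (htw : 1 ≤ t * w ^ 2 * f w) (u : ℝ) :
    ‖Complex.exp (t * Θ w (u / √(t * f w)))‖ ≤
      Real.exp (-(A * c * |u| ^ α)) + Real.exp (-A * u ^ 2) := by
  have hw0 : 0 < w := hx₀.trans_lt hw
  have hf := hfpos w hw0
  have hs : 0 < √(t * f w) := Real.sqrt_pos.2 (by positivity)
  have hs2 : √(t * f w) ^ 2 = t * f w := Real.sq_sqrt (by positivity)
  set s := √(t * f w) with hsdef
  have hT : 1 ≤ s * w := by
    by_contra! h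
    have : (s * w) ^ 2 < 1 := by
      rw [sq_lt_one_iff₀ (by positivity)]; exact h
    rw [mul_pow, hs2] at this
    linarith
  rw [Complex.norm_exp, Complex.re_ofReal_mul]
  rcases le_or_gt |u / s| w with h | h
  · have h1 := hre w (u / s) w hw le_rfl h
    have h2 : t * (Θ w (u / s)).re ≤ -A * u ^ 2 := by
      calc _ ≤ t * -(A * ((u / s) ^ 2 * f w)) := by gcongr
        _ = -A * u ^ 2 * (t * f w / s ^ 2) := by rw [div_pow]; ring
        _ = _ := by rw [hs2, div_self (by positivity), mul_one]
    have := Real.exp_le_exp.2 h2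
    have := Real.exp_pos (-(A * c * |u| ^ α))
    linarith
  · have h1 := hre w (u / s) |u / s| hw h.le le_rfl
    have hξ : 0 < |u / s| := hw0.trans h
    have h3 := hscal.sq_mul_ge hw hw0 h.le
    have habs : |u / s| = |u| / s := by rw [abs_div, abs_of_pos hs]
    have hu : 0 < |u| := by rw [habs] at hξ; exact (div_pos_iff_of_pos_right hs).1 hξ
    have hratio : |u / s| / w = |u| / (s * w) := by rw [habs, div_div]
    have hpow : |u| ^ α ≤ (s * w) ^ 2 * (|u / s| / w) ^ α := by
      rw [hratio, Real.div_rpow hu.le (by positivity), mul_div_assoc', le_div_iff₀ (by positivity),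
        mul_comm]
      gcongr
      rw [← Real.rpow_two]
      exact Real.rpow_le_rpow_of_exponent_le hT hα2
    have h2 : t * (Θ w (u / s)).re ≤ -(A * c * |u| ^ α) := by
      rw [← sq_abs (u / s)] at h1
      calc _ ≤ t * -(A * (|u / s| ^ 2 * f |u / s|)) := by gcongr
        _ ≤ t * -(A * (c * (|u / s| / w) ^ α * (w ^ 2 * f w))) := by gcongr
        _ = -(A * c * ((s * w) ^ 2 * (|u / s| / w) ^ α)) := by rw [mul_pow, hs2]; ring
        _ ≤ _ := by gcongr
    have := Real.exp_le_exp.2 h2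
    have := Real.exp_pos (-A * u ^ 2)
    linarith

lemma tendsto_cexp_saddle (hx₀ : 0 ≤ x₀) (hfpos : ∀ l : ℝ, 0 < l → 0 < f l)
    (hcub : ∀ w ξ, x₀ < w → |ξ| ≤ w / 4 →
      ‖Θ w ξ + f w * ξ ^ 2 / 2‖ ≤ E * |ξ| ^ 3 * f w / w) (u : ℝ) :
    Tendsto (fun p : ℝ × ℝ => Complex.exp (p.1 * Θ p.2 (u / √(p.1 * f p.2))))
      (saddleFilter f x₀) (𝓝 ((Real.exp (-(1 / 2) * u ^ 2) : ℝ) : ℂ)) := by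
  have hT : Tendsto (fun p : ℝ × ℝ => √(p.1 * p.2 ^ 2 * f p.2)) (saddleFilter f x₀) atTop :=
    Real.tendsto_sqrt_atTop.comp tendsto_saddleFilter
  rw [Complex.ofReal_exp]
  refine (Complex.continuous_exp.tendsto _).comp ?_
  rw [tendsto_iff_norm_sub_tendsto_zero]
  have h0 : Tendsto (fun p : ℝ × ℝ => E * |u| ^ 3 / √(p.1 * p.2 ^ 2 * f p.2))
      (saddleFilter f x₀) (𝓝 0) := hT.const_div_atTop _
  refine squeeze_zero' (Eventually.of_forall fun _ => norm_nonneg _) ?_ h0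
  filter_upwards [eventually_saddleFilter_mem, hT.eventually_ge_atTop (4 * |u|)]
    with ⟨t, w⟩ ⟨ht, hw⟩ hTu
  simp only at ht hw hTu ⊢
  have hw0 : 0 < w := hx₀.trans_lt hw
  have hf := hfpos w hw0
  have hs : 0 < √(t * f w) := Real.sqrt_pos.2 (by positivity)
  have hs2 : √(t * f w) ^ 2 = t * f w := Real.sq_sqrt (by positivity)
  have hTs : √(t * w ^ 2 * f w) = √(t * f w) * w := by
    rw [show t * w ^ 2 * f w = (t * f w) * w ^ 2 by ring, Real.sqrt_mul (by positivity),
      Real.sqrt_sq hw0.le]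
  rw [hTs] at hTu ⊢
  set s := √(t * f w) with hsdef
  have habs : |u / s| = |u| / s := by rw [abs_div, abs_of_pos hs]
  have hξ : |u / s| ≤ w / 4 := by
    rw [habs, div_le_iff₀ hs]; linarith
  have h := hcub w (u / s) hw hξ
  have hsC : (s : ℂ) ^ 2 = t * f w := by exact_mod_cast congrArg (Complex.ofReal) hs2
  have hsC0 : (s : ℂ) ≠ 0 := by exact_mod_cast hs.ne'
  have e1 : (t : ℂ) * Θ w (u / s) - ((-(1 / 2) * u ^ 2 : ℝ) : ℂ) =
      t * (Θ w (u / s) + f w * ((u / s : ℝ) : ℂ) ^ 2 / 2) := by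
    have : (t : ℂ) * (f w * ((u / s : ℝ) : ℂ) ^ 2 / 2) = (u : ℂ) ^ 2 / 2 := by
      push_cast
      calc _ = (u : ℂ) ^ 2 / 2 * ((t * f w) / s ^ 2) := by ring
        _ = _ := by rw [← hsC, div_self (pow_ne_zero 2 hsC0), mul_one]
    rw [mul_add, this]
    push_cast
    ring
  rw [e1, norm_mul, Complex.norm_real, Real.norm_of_nonneg ht.le]
  calc _ ≤ t * (E * |u / s| ^ 3 * f w / w) := by gcongr
    _ = E * |u| ^ 3 / (s * w) * ((t * f w) / s ^ 2) := by rw [habs]; field_simp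
    _ = _ := by rw [hs2, div_self (by positivity), mul_one]

/-- Laplace's method, uniformly in the saddle point `w`. -/
theorem tendsto_integral_cexp_saddle (hA : 0 < A) (hα : 0 < α) (hα2 : α ≤ 2) (hc : 0 < c)
    (hx₀ : 0 ≤ x₀) (hfpos : ∀ l : ℝ, 0 < l → 0 < f l) (hscal : WLSC f (α - 2) c x₀)
    (hcont : ∀ w, x₀ < w → Continuous (Θ w))
    (hre : ∀ w ξ r, x₀ < w → w ≤ r → |ξ| ≤ r → (Θ w ξ).re ≤ -(A * (ξ ^ 2 * f r)))
    (hcub : ∀ w ξ, x₀ < w → |ξ| ≤ w / 4 →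
      ‖Θ w ξ + f w * ξ ^ 2 / 2‖ ≤ E * |ξ| ^ 3 * f w / w) :
    Tendsto (fun p : ℝ × ℝ => ∫ u : ℝ, Complex.exp (p.1 * Θ p.2 (u / √(p.1 * f p.2))))
      (saddleFilter f x₀) (𝓝 ((√(2 * π) : ℝ) : ℂ)) := by
  have hgauss : ∫ u : ℝ, ((Real.exp (-(1 / 2) * u ^ 2) : ℝ) : ℂ) = ((√(2 * π) : ℝ) : ℂ) := by
    rw [integral_complex_ofReal, integral_gaussian]
    congr 2
    ring
  rw [← hgauss]
  refine tendsto_integral_filter_of_dominated_convergence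
    (fun u => Real.exp (-(A * c * |u| ^ α)) + Real.exp (-A * u ^ 2)) ?_ ?_ ?_ ?_
  · filter_upwards [eventually_saddleFilter_mem] with p hp
    have := (hcont p.2 hp.2)
    exact Continuous.aestronglyMeasurable (by fun_prop)
  · filter_upwards [eventually_saddleFilter_mem,
      tendsto_saddleFilter.eventually_ge_atTop 1] with p hp h1
    exact Eventually.of_forall
      (norm_cexp_saddle_le hA hα2 hc hx₀ hfpos hscal hre hp.1 hp.2 h1)
  · exact (integrable_exp_neg_mul_abs_rpow (mul_pos hA hc) hα).add (integrable_exp_neg_mul_sq hA)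
  · exact Eventually.of_forall (tendsto_cexp_saddle hx₀ hfpos hcub)

end Saddle

section Exponent

variable {σ b : ℝ} {ν : Measure ℝ}

lemma integrable_min_one_sq
    (hint : ∫⁻ x in Ioi (0:ℝ), ENNReal.ofReal (min 1 (x ^ 2)) ∂ν ≠ ⊤) :
    Integrable (fun x : ℝ => min 1 (x ^ 2)) (ν.restrict (Ioi 0)) := by
  refine (lintegral_ofReal_ne_top_iff_integrable ?_ ?_).1 hint
  · exact Measurable.aestronglyMeasurable (by fun_prop)
  · exact Eventually.of_forall fun x => by positivity

lemma laplaceC_ofReal (l : ℝ) :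
    laplaceC σ b ν (l : ℂ) = ((σ ^ 2 * l ^ 2 - b * l +
      ∫ x in Ioi (0:ℝ), (Real.exp (-(l * x)) - 1 + l * x * (if x < 1 then 1 else 0)) ∂ν : ℝ) : ℂ) := by
  rw [laplaceC_eq]
  push_cast
  congr 1
  rw [← integral_complex_ofReal]
  refine integral_congr_ae (Eventually.of_forall fun x => ?_)
  simp only [levyKernel]
  split_ifs <;> push_cast <;> rfl

lemma laplaceC_neg_mul_I (ξ : ℝ) :
    laplaceC σ b ν (((-ξ : ℝ) : ℂ) * Complex.I) = -charExp σ b ν ξ := by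
  have h1 : ((((-ξ : ℝ) : ℂ)) * Complex.I) ^ 2 = -(ξ : ℂ) ^ 2 := by
    rw [mul_pow, Complex.I_sq]; push_cast; ring
  rw [laplaceC, charExp, h1]
  have h2 : ∀ x : ℝ, Complex.exp (-(((-ξ : ℝ) : ℂ) * Complex.I * (x : ℂ))) - 1 +
      ((-ξ : ℝ) : ℂ) * Complex.I * (x : ℂ) * (if x < 1 then (1:ℂ) else 0) =
      Complex.exp (Complex.I * (ξ : ℂ) * (x : ℂ)) - 1 -
      Complex.I * (ξ : ℂ) * (x : ℂ) * (if x < 1 then (1:ℂ) else 0) := by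
    intro x
    have : -(((-ξ : ℝ) : ℂ) * Complex.I * (x : ℂ)) = Complex.I * (ξ : ℂ) * (x : ℂ) := by
      push_cast; ring
    rw [this]; push_cast; ring
  simp only [h2]
  push_cast
  ring

lemma continuousOn_laplaceC (hm : Integrable (fun x : ℝ => min 1 (x ^ 2)) (ν.restrict (Ioi 0))) :
    ContinuousOn (laplaceC σ b ν) {z : ℂ | 0 ≤ z.re} := by
  have h := continuousOn_integral_levyKernel hm (ae_restrict_Ioi_pos ν)
  have h2 : ContinuousOn (fun z : ℂ => (σ : ℂ) ^ 2 * z ^ 2 - (b : ℂ) * z) {z : ℂ | 0 ≤ z.re} := by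
    fun_prop
  exact h2.add h

/-- The complex derivative of `laplaceC` in the right half-plane. -/
def laplaceCDeriv (σ b : ℝ) (ν : Measure ℝ) (z : ℂ) : ℂ :=
  2 * (σ : ℂ) ^ 2 * z - b + ∫ x in Ioi (0:ℝ), levyKernelDeriv z x ∂ν

lemma hasDerivAt_laplaceC (hm : Integrable (fun x : ℝ => min 1 (x ^ 2)) (ν.restrict (Ioi 0)))
    {z : ℂ} (hz : 0 < z.re) : HasDerivAt (laplaceC σ b ν) (laplaceCDeriv σ b ν z) z := by
  have h := hasDerivAt_integral_levyKernel hm (ae_restrict_Ioi_pos ν) hz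
  have h2 : HasDerivAt (fun z : ℂ => (σ : ℂ) ^ 2 * z ^ 2 - (b : ℂ) * z)
      (2 * (σ : ℂ) ^ 2 * z - b) z := by
    have := (((hasDerivAt_id z).pow 2).const_mul ((σ : ℂ) ^ 2)).sub
      ((hasDerivAt_id z).const_mul (b : ℂ))
    convert! this using 1
    simp
    ring
  exact h2.add h

lemma laplaceCDeriv_ofReal (hm : Integrable (fun x : ℝ => min 1 (x ^ 2)) (ν.restrict (Ioi 0)))
    {φ : ℝ → ℝ} (hφ : ∀ l : ℝ, 0 ≤ l → laplaceC σ b ν l = φ l) {w d : ℝ} (hw : 0 < w)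
    (hd : HasDerivAt φ d w) : laplaceCDeriv σ b ν w = d := by
  have h1 : HasDerivAt (fun l : ℝ => laplaceC σ b ν l) (laplaceCDeriv σ b ν w) w :=
    (hasDerivAt_laplaceC hm (by simpa using hw)).comp_ofReal
  have h2 : HasDerivAt (fun l : ℝ => (φ l : ℂ)) d w := hd.ofReal_comp
  refine h1.unique (h2.congr_of_eventuallyEq ?_)
  filter_upwards [lt_mem_nhds hw] with l hl using hφ l hl.le

/-- The second-order Taylor remainder of `laplaceC` along the vertical line through `w`. -/
lemma norm_laplaceC_taylor_le
    (hm : Integrable (fun x : ℝ => min 1 (x ^ 2)) (ν.restrict (Ioi 0)))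
    {w ξ : ℝ} (hw : 0 < w) (hξ : |ξ| ≤ w / 4) :
    ‖laplaceC σ b ν (w + ξ * Complex.I) - laplaceC σ b ν w - ξ * Complex.I * laplaceCDeriv σ b ν w +
      ((2 * σ ^ 2 + ∫ x in Ioi (0:ℝ), x ^ 2 * Real.exp (-(w * x)) ∂ν : ℝ) : ℂ) * ξ ^ 2 / 2‖ ≤
      4 * |ξ| ^ 3 / w * ∫ x in Ioi (0:ℝ), x ^ 2 * Real.exp (-(w / 2 * x)) ∂ν := by
  have hpos := ae_restrict_Ioi_pos ν
  have hi1 := integrable_levyKernel hm hpos (z := w + ξ * Complex.I) (by simpa using hw.le)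
  have hi2 := integrable_levyKernel hm hpos (z := w) (by simpa using hw.le)
  have hi3 : Integrable (levyKernelDeriv w) (ν.restrict (Ioi 0)) :=
    integrable_of_norm_le_min_one_sq hm hpos (measurable_levyKernelDeriv _).aestronglyMeasurable
      _ fun x hx => norm_levyKernelDeriv_le hw (by simp) le_rfl hx
  have hi4 : Integrable (fun x => ((x ^ 2 * Real.exp (-(w * x)) : ℝ) : ℂ)) (ν.restrict (Ioi 0)) :=
    (integrable_sq_mul_exp hm hw).ofReal
  have key : laplaceC σ b ν (w + ξ * Complex.I) - laplaceC σ b ν w -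
      ξ * Complex.I * laplaceCDeriv σ b ν w +
      ((2 * σ ^ 2 + ∫ x in Ioi (0:ℝ), x ^ 2 * Real.exp (-(w * x)) ∂ν : ℝ) : ℂ) * ξ ^ 2 / 2 =
      ∫ x in Ioi (0:ℝ), (levyKernel (w + ξ * Complex.I) x - levyKernel w x -
        ξ * Complex.I * levyKernelDeriv w x +
          (ξ ^ 2 / 2 : ℂ) * ((x ^ 2 * Real.exp (-(w * x)) : ℝ) : ℂ)) ∂ν := by
    have hi12 : Integrable (fun x => levyKernel (w + ξ * Complex.I) x - levyKernel w x)
      (ν.restrict (Ioi 0)) := hi1.sub hi2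
    have hi3' := hi3.const_mul (ξ * Complex.I)
    have hi123 : Integrable (fun x => levyKernel (w + ξ * Complex.I) x - levyKernel w x -
      ξ * Complex.I * levyKernelDeriv w x) (ν.restrict (Ioi 0)) := hi12.sub hi3'
    rw [integral_add hi123 (hi4.const_mul _), integral_sub hi12 hi3', integral_sub hi1 hi2,
      integral_const_mul, integral_const_mul, laplaceC_eq, laplaceC_eq, laplaceCDeriv,
      Complex.ofReal_add, ← integral_complex_ofReal]
    push_cast
    linear_combination (σ : ℂ) ^ 2 * (ξ : ℂ) ^ 2 * Complex.I_sq
  rw [key, ← integral_const_mul]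
  refine norm_integral_le_of_norm_le ((integrable_sq_mul_exp hm (half_pos hw)).const_mul _) ?_
  filter_upwards [hpos] with x hx
  have hexp : Complex.exp (-((w + ξ * Complex.I) * (x : ℂ))) =
      Complex.exp (-(w * x)) * Complex.exp (-(ξ * x * Complex.I)) := by
    rw [← Complex.exp_add]; congr 1; ring
  have heq : levyKernel (w + ξ * Complex.I) x - levyKernel w x -
        ξ * Complex.I * levyKernelDeriv w x +
          (ξ ^ 2 / 2 : ℂ) * ((x ^ 2 * Real.exp (-(w * x)) : ℝ) : ℂ) =
      Complex.exp (-(w * x)) * (Complex.exp (-(ξ * x * Complex.I)) -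
        ∑ i ∈ Finset.range 3, (-(ξ * x * Complex.I)) ^ i / i.factorial) := by
    simp only [levyKernel, levyKernelDeriv, hexp, Finset.sum_range_succ, Finset.sum_range_zero]
    push_cast
    simp only [Nat.factorial, Nat.cast_one, pow_zero, pow_one]
    push_cast
    linear_combination (1 / 2 * (ξ : ℂ) ^ 2 * (x : ℂ) ^ 2 * Complex.exp (-(w * x))) *
      Complex.I_sq
  have hn : ‖-((ξ : ℂ) * x * Complex.I)‖ = |ξ| * x := by simp [abs_of_pos hx]
  have hT := Complex.norm_exp_sub_sum_le_norm_mul_exp (-((ξ : ℂ) * x * Complex.I)) 3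
  rw [hn] at hT
  have hw' : ‖Complex.exp (-((w : ℂ) * x))‖ = Real.exp (-(w * x)) := by
    rw [← Complex.ofReal_mul, ← Complex.ofReal_neg, Complex.norm_exp_ofReal]
  rw [heq, norm_mul, hw']
  have hx4 : x ≤ 4 / w * Real.exp (w / 4 * x) := by
    rw [div_mul_eq_mul_div, le_div_iff₀ hw]
    have := Real.add_one_le_exp (w / 4 * x)
    linarith
  have he : Real.exp (|ξ| * x) ≤ Real.exp (w / 4 * x) := by gcongr
  calc Real.exp (-(w * x)) * _ ≤ Real.exp (-(w * x)) *
        ((|ξ| * x) ^ 3 * Real.exp (|ξ| * x)) := by gcongr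
    _ = |ξ| ^ 3 * x ^ 2 * Real.exp (-(w * x)) * (x * Real.exp (|ξ| * x)) := by ring
    _ ≤ |ξ| ^ 3 * x ^ 2 * Real.exp (-(w * x)) *
        (4 / w * Real.exp (w / 4 * x) * Real.exp (w / 4 * x)) := by gcongr
    _ = 4 * |ξ| ^ 3 / w * (x ^ 2 * (Real.exp (-(w * x)) *
        Real.exp (w / 4 * x) * Real.exp (w / 4 * x))) := by ring
    _ = _ := by
      rw [← Real.exp_add, ← Real.exp_add]
      ring_nf

end Exponent

section Inversion

variable {σ b : ℝ} {ν : Measure ℝ} {f : ℝ → ℝ} {α c x₀ A : ℝ}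

lemma exists_re_laplaceC_le
    (hm : Integrable (fun x : ℝ => min 1 (x ^ 2)) (ν.restrict (Ioi 0)))
    (hf : ∀ l : ℝ, 0 < l → f l = 2 * σ ^ 2 + ∫ x in Ioi (0:ℝ), x ^ 2 * Real.exp (-(l * x)) ∂ν)
    (hc : 0 < c) (hx₀ : 0 ≤ x₀) (hscal : WLSC f (α - 2) c x₀) :
    ∃ A : ℝ, 0 < A ∧ ∀ s ξ r, 0 ≤ s → x₀ < r → s ≤ r → |ξ| ≤ r →
      (laplaceC σ b ν (s + ξ * Complex.I)).re ≤ (laplaceC σ b ν s).re - A * (ξ ^ 2 * f r) := by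
  obtain ⟨a, ha, hV⟩ := exists_truncatedVariance_ge hm hf hc hx₀ hscal
  refine ⟨2 / π ^ 2 * Real.exp (-1) * a, by positivity, fun s ξ r hs hr hsr hξ => ?_⟩
  refine (re_laplaceC_le hm hs (hx₀.trans_lt hr) hsr hξ).trans ?_
  have h1 : 2 / π ^ 2 * Real.exp (-1) * ξ ^ 2 * (a * f r) ≤
      2 / π ^ 2 * Real.exp (-1) * ξ ^ 2 * truncatedVariance σ ν r := by
    gcongr
    exact hV r hr
  linarith

/-- Stretched-exponential decay of `exp (t φ(z) + x z)` on a vertical strip. -/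
lemma exists_norm_cexp_laplaceC_le
    (hm : Integrable (fun x : ℝ => min 1 (x ^ 2)) (ν.restrict (Ioi 0)))
    (hfpos : ∀ l : ℝ, 0 < l → 0 < f l) (hc : 0 < c) (hx₀ : 0 ≤ x₀)
    (hscal : WLSC f (α - 2) c x₀) (hA : 0 < A)
    (hre : ∀ s ξ r, 0 ≤ s → x₀ < r → s ≤ r → |ξ| ≤ r →
      (laplaceC σ b ν (s + ξ * Complex.I)).re ≤ (laplaceC σ b ν s).re - A * (ξ ^ 2 * f r))
    {t : ℝ} (ht : 0 < t) (x w : ℝ) :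
    ∃ K B X : ℝ, 0 < B ∧ ∀ s ∈ Icc (0:ℝ) w, ∀ ξ : ℝ, X ≤ |ξ| →
      ‖Complex.exp (t * laplaceC σ b ν (s + ξ * Complex.I) + x * (s + ξ * Complex.I))‖ ≤
        K * Real.exp (-(B * |ξ| ^ α)) := by
  have hcont : ContinuousOn (fun s : ℝ => t * (laplaceC σ b ν s).re + x * s) (Icc 0 w) := by
    have h1 : ContinuousOn (fun s : ℝ => laplaceC σ b ν s) (Icc 0 w) :=
      (continuousOn_laplaceC hm).comp Complex.continuous_ofReal.continuousOn
        fun s hs => by simpa using hs.1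
    have h2 : ContinuousOn (fun s : ℝ => (laplaceC σ b ν s).re) (Icc 0 w) :=
      Complex.continuous_re.comp_continuousOn h1
    fun_prop
  obtain ⟨K, hK⟩ := isCompact_Icc.exists_bound_of_continuousOn hcont
  have hx₁ : 0 < x₀ + 1 := by linarith
  have hf₁ := hfpos _ hx₁
  refine ⟨Real.exp K, t * A * (c * (x₀ + 1) ^ 2 * f (x₀ + 1) / (x₀ + 1) ^ α), max w (x₀ + 1),
    by positivity, fun s hs ξ hξ => ?_⟩
  have hξw : w ≤ |ξ| := (le_max_left _ _).trans hξ
  have hξx : x₀ + 1 ≤ |ξ| := (le_max_right _ _).trans hξ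
  have h1 := hre s ξ |ξ| hs.1 (by linarith) (hs.2.trans hξw) le_rfl
  have h2 := hscal.sq_mul_ge (lt_add_one x₀) hx₁ hξx
  rw [Real.div_rpow (abs_nonneg _) hx₁.le, sq_abs] at h2
  have h3 : t * A * (c * (|ξ| ^ α / (x₀ + 1) ^ α) * ((x₀ + 1) ^ 2 * f (x₀ + 1))) ≤
      t * A * (ξ ^ 2 * f |ξ|) := by gcongr
  have h4 : t * (laplaceC σ b ν s).re + x * s ≤ K := (le_abs_self _).trans (hK s hs)
  rw [Complex.norm_exp, ← Real.exp_add]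
  apply Real.exp_le_exp.2
  have h5 : (t * laplaceC σ b ν (s + ξ * Complex.I) + x * (s + ξ * Complex.I)).re =
      t * (laplaceC σ b ν (s + ξ * Complex.I)).re + x * s := by simp
  rw [h5]
  calc t * (laplaceC σ b ν (s + ξ * Complex.I)).re + x * s ≤
        t * ((laplaceC σ b ν s).re - A * (ξ ^ 2 * f |ξ|)) + x * s := by gcongr
    _ ≤ K - t * A * (c * (|ξ| ^ α / (x₀ + 1) ^ α) * ((x₀ + 1) ^ 2 * f (x₀ + 1))) := by linarith
    _ = _ := by ring

lemma continuousOn_cexp_laplaceC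
    (hm : Integrable (fun x : ℝ => min 1 (x ^ 2)) (ν.restrict (Ioi 0))) (t x : ℝ) :
    ContinuousOn (fun z => Complex.exp (t * laplaceC σ b ν z + x * z)) {z : ℂ | 0 ≤ z.re} := by
  have := continuousOn_laplaceC (σ := σ) (b := b) hm
  fun_prop

lemma integrable_cexp_charExp
    (hm : Integrable (fun x : ℝ => min 1 (x ^ 2)) (ν.restrict (Ioi 0)))
    (hfpos : ∀ l : ℝ, 0 < l → 0 < f l) (hα : 0 < α) (hc : 0 < c) (hx₀ : 0 ≤ x₀)
    (hscal : WLSC f (α - 2) c x₀) (hA : 0 < A)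
    (hre : ∀ s ξ r, 0 ≤ s → x₀ < r → s ≤ r → |ξ| ≤ r →
      (laplaceC σ b ν (s + ξ * Complex.I)).re ≤ (laplaceC σ b ν s).re - A * (ξ ^ 2 * f r))
    {t : ℝ} (ht : 0 < t) :
    Integrable (fun ξ : ℝ => Complex.exp (-(t : ℂ) * charExp σ b ν ξ)) := by
  obtain ⟨K, B, X, hB, hle⟩ := exists_norm_cexp_laplaceC_le hm hfpos hc hx₀ hscal hA hre ht 0 0
  have h := (integrable_vertical_line (continuousOn_cexp_laplaceC hm t 0)
    ((integrable_exp_neg_mul_abs_rpow hB hα).const_mul K) le_rfl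
    (hle 0 ⟨le_rfl, le_rfl⟩)).comp_neg
  refine h.congr (Eventually.of_forall fun ξ => ?_)
  have := laplaceC_neg_mul_I (σ := σ) (b := b) (ν := ν) ξ
  simp only [Complex.ofReal_zero, zero_mul, add_zero, zero_add, this]
  congr 1
  ring

/-- Fourier inversion along the vertical line through `w > 0`. -/
lemma fourierDensity_charExp_eq
    (hm : Integrable (fun x : ℝ => min 1 (x ^ 2)) (ν.restrict (Ioi 0)))
    (hfpos : ∀ l : ℝ, 0 < l → 0 < f l) (hα : 0 < α) (hc : 0 < c) (hx₀ : 0 ≤ x₀)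
    (hscal : WLSC f (α - 2) c x₀) (hA : 0 < A)
    (hre : ∀ s ξ r, 0 ≤ s → x₀ < r → s ≤ r → |ξ| ≤ r →
      (laplaceC σ b ν (s + ξ * Complex.I)).re ≤ (laplaceC σ b ν s).re - A * (ξ ^ 2 * f r))
    {t w : ℝ} (ht : 0 < t) (hw : 0 < w) (x : ℝ) :
    fourierDensity (fun ξ => Complex.exp (-(t : ℂ) * charExp σ b ν ξ)) x = 1 / (2 * π) *
      (∫ ξ : ℝ, Complex.exp (t * laplaceC σ b ν (w + ξ * Complex.I) +
        x * (w + ξ * Complex.I))).re := by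
  obtain ⟨K, B, X, hB, hle⟩ := exists_norm_cexp_laplaceC_le hm hfpos hc hx₀ hscal hA hre ht x w
  have h0 : Tendsto (fun ξ : ℝ => K * Real.exp (-(B * |ξ| ^ α))) (cocompact ℝ) (nhds 0) := by
    simpa using (tendsto_exp_neg_mul_abs_rpow_cocompact hB hα).const_mul K
  have hd : ∀ z : ℂ, 0 < z.re → DifferentiableAt ℂ
      (fun z => Complex.exp (t * laplaceC σ b ν z + x * z)) z := by
    intro z hz
    have := (hasDerivAt_laplaceC (σ := σ) (b := b) hm hz).differentiableAt
    fun_prop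
  have h := integral_vertical_line_eq (continuousOn_cexp_laplaceC hm t x) hd
    ((integrable_exp_neg_mul_abs_rpow hB hα).const_mul K) h0 hw hle
  rw [← h, fourierDensity, ← integral_neg_eq_self (fun ξ : ℝ =>
    Complex.exp (-(Complex.I * ξ * x)) * Complex.exp (-(t : ℂ) * charExp σ b ν ξ))]
  congr 3
  ext ξ
  rw [← Complex.exp_add]
  have := laplaceC_neg_mul_I (σ := σ) (b := b) (ν := ν) (-ξ)
  rw [neg_neg] at this
  rw [this]
  congr 1
  push_cast
  ring

end Inversion

/-- Normalization of a vertical-line integral at a saddle point: `ψ` is an exponent along the line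
through `w`, with value `a` and derivative `d` at `w`, and `θ` its first-order Taylor remainder. -/
lemma saddle_normalization {ψ θ : ℝ → ℂ} {t w a d v : ℝ} (ht : 0 < t) (hv : 0 < v)
    (hψ : ∀ ξ, ψ ξ = a + ξ * Complex.I * d + θ ξ) :
    1 / (2 * π) * (∫ ξ : ℝ, Complex.exp (t * ψ ξ + (-(t * d) : ℝ) * (w + ξ * Complex.I))).re *
      √(2 * π * t * v) * Real.exp (t * (w * d - a)) =
      (∫ u : ℝ, Complex.exp (t * θ (u / √(t * v)))).re / √(2 * π) := by
  have hs : 0 < √(t * v) := Real.sqrt_pos.2 (by positivity)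
  have h1 : ∀ ξ : ℝ, Complex.exp (t * ψ ξ + (-(t * d) : ℝ) * (w + ξ * Complex.I)) =
      (Real.exp (-(t * (w * d - a))) : ℂ) * Complex.exp (t * θ ξ) := by
    intro ξ
    rw [Complex.ofReal_exp, ← Complex.exp_add, hψ]
    congr 1
    push_cast
    ring
  have h2 : ∫ u : ℝ, Complex.exp (t * θ (u / √(t * v))) =
      (√(t * v) : ℂ) * ∫ ξ : ℝ, Complex.exp (t * θ ξ) := by
    rw [Measure.integral_comp_div (fun ξ : ℝ => Complex.exp (t * θ ξ)), abs_of_pos hs,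
      Complex.real_smul]
  have h3 : √(2 * π * t * v) = √(2 * π) * √(t * v) := by
    rw [← Real.sqrt_mul (by positivity)]; congr 1; ring
  have h4 : √(2 * π) * √(2 * π) = 2 * π := Real.mul_self_sqrt (by positivity)
  have h5 : Real.exp (-(t * (w * d - a))) * Real.exp (t * (w * d - a)) = 1 := by
    rw [← Real.exp_add]; simp
  have h6 : 0 < √(2 * π) := Real.sqrt_pos.2 (by positivity)
  simp only [h1]
  rw [integral_const_mul, h2, Complex.re_ofReal_mul, Complex.re_ofReal_mul, h3,
    eq_div_iff h6.ne']
  have h7 : 1 / (2 * π) * (√(2 * π) * √(2 * π)) = 1 := by rw [h4]; field_simp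
  linear_combination √(t * v) * (∫ ξ : ℝ, Complex.exp (t * θ ξ)).re *
    (1 / (2 * π) * (√(2 * π) * √(2 * π)) * h5 + h7)

/-- Theorem 1. -/
theorem statement9
    (ν : Measure ℝ) [SigmaFinite ν]
    (hint : ∫⁻ x in Ioi (0:ℝ), ENNReal.ofReal (min 1 (x ^ 2)) ∂ν ≠ ⊤)
    (σ b : ℝ) (hσ : 0 ≤ σ)
    (φ φ' φ'' : ℝ → ℝ)
    (hφ : ∀ l : ℝ, 0 ≤ l → φ l = σ ^ 2 * l ^ 2 - b * l +
      ∫ x in Ioi (0:ℝ), (Real.exp (-(l * x)) - 1 + l * x * (if x < 1 then 1 else 0)) ∂ν)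
    (hD1 : ∀ x : ℝ, 0 < x → HasDerivAt φ (φ' x) x)
    (hD2 : ∀ x : ℝ, 0 < x → HasDerivAt φ' (φ'' x) x)
    (hφ'' : ∀ l : ℝ, 0 < l → φ'' l = 2 * σ ^ 2 + ∫ x in Ioi (0:ℝ), x ^ 2 * Real.exp (-(l * x)) ∂ν)
    (hUV : 0 < σ ∨ ∫⁻ x in Ioo (0:ℝ) 1, ENNReal.ofReal x ∂ν = ⊤)
    (μ : ℝ → Measure ℝ)
    (hprob : ∀ t : ℝ, 0 < t → IsProbabilityMeasure (μ t))
    (hchar : ∀ t : ℝ, 0 < t → ∀ ξ : ℝ,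
      ∫ x : ℝ, Complex.exp (Complex.I * (ξ : ℂ) * (x : ℂ)) ∂(μ t) =
        Complex.exp (-(t : ℂ) * charExp σ b ν ξ))
    (α c x₀ : ℝ) (hα : 0 < α) (hc : c ∈ Ioc (0:ℝ) 1) (hx₀ : 0 ≤ x₀)
    (hscal : WLSC φ'' (α - 2) c x₀) :
    ∃ p : ℝ → ℝ → ℝ,
      (∀ t : ℝ, 0 < t → μ t = volume.withDensity (fun x => ENNReal.ofReal (p t x))) ∧
      ∀ ε : ℝ, 0 < ε → ∃ M₀ : ℝ, 0 < M₀ ∧ ∀ t w : ℝ, 0 < t → x₀ < w →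
        M₀ < t * w ^ 2 * φ'' w →
        |p t (-(t * φ' w)) * Real.sqrt (2 * π * t * φ'' w) *
          Real.exp (t * (w * φ' w - φ w)) - 1| ≤ ε := by
  have hm := integrable_min_one_sq hint
  have hfpos : ∀ l : ℝ, 0 < l → 0 < φ'' l := fun l hl =>
    pos_of_unbounded_variation hm hφ'' hUV hl
  have hβ : 0 < min α 2 := lt_min hα two_pos
  have hscal' : WLSC φ'' (min α 2 - 2) c x₀ :=
    hscal.mono_exponent (by gcongr; exact min_le_left _ _) hc.1.le
      fun x hx => (hfpos x (hx₀.trans_lt hx)).le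
  obtain ⟨A, hA, hre⟩ := exists_re_laplaceC_le (b := b) hm hφ'' hc.1 hx₀ hscal'
  obtain ⟨D, hD, hdoub⟩ := exists_doubling hm hφ'' hfpos hc.1 hx₀ hscal'
  have hφC : ∀ l : ℝ, 0 ≤ l → laplaceC σ b ν l = φ l := fun l hl => by
    rw [laplaceC_ofReal, hφ l hl]
  have hchar_int := fun t ht => integrable_cexp_charExp (t := t) hm hfpos hβ hc.1 hx₀ hscal' hA hre ht
  refine ⟨fun t => fourierDensity fun ξ => Complex.exp (-(t : ℂ) * charExp σ b ν ξ),
    fun t ht => ?_, fun ε hε => ?_⟩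
  · have := hprob t ht
    exact eq_withDensity_fourierDensity (hchar t ht) (hchar_int t ht)
  set Θ : ℝ → ℝ → ℂ := fun w ξ =>
    laplaceC σ b ν (w + ξ * Complex.I) - φ w - ξ * Complex.I * φ' w with hΘ
  have hcont : ∀ w, x₀ < w → Continuous (Θ w) := by
    intro w hw
    have h1 : Continuous fun ξ : ℝ => laplaceC σ b ν (w + ξ * Complex.I) :=
      (continuousOn_laplaceC hm).comp_continuous (by fun_prop)
        fun ξ => by simpa using (hx₀.trans_lt hw).le
    fun_prop
  have hΘre : ∀ w ξ r, x₀ < w → w ≤ r → |ξ| ≤ r → (Θ w ξ).re ≤ -(A * (ξ ^ 2 * φ'' r)) := by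
    intro w ξ r hw hwr hξ
    have hw0 := (hx₀.trans_lt hw).le
    have h1 := hre w ξ r hw0 (hw.trans_le hwr) hwr hξ
    rw [hφC w hw0] at h1
    simp only [Complex.ofReal_re] at h1
    simp only [hΘ, Complex.sub_re, Complex.ofReal_re, Complex.mul_re, Complex.mul_im,
      Complex.I_re, Complex.I_im, Complex.ofReal_im]
    linarith
  have hcub : ∀ w ξ, x₀ < w → |ξ| ≤ w / 4 →
      ‖Θ w ξ + φ'' w * ξ ^ 2 / 2‖ ≤ 4 * D * |ξ| ^ 3 * φ'' w / w := by
    intro w ξ hw hξ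
    have hw0 := hx₀.trans_lt hw
    have h1 := norm_laplaceC_taylor_le (σ := σ) (b := b) hm hw0 hξ
    rw [← hφ'' w hw0, hφC w hw0.le, laplaceCDeriv_ofReal hm hφC hw0 (hD1 w hw0)] at h1
    have h2 := hφ'' (w / 2) (half_pos hw0)
    have h3 : ∫ x in Ioi (0:ℝ), x ^ 2 * Real.exp (-(w / 2 * x)) ∂ν ≤ D * φ'' w :=
      le_trans (by nlinarith [sq_nonneg σ]) (hdoub w hw)
    calc _ ≤ _ := h1
      _ ≤ 4 * |ξ| ^ 3 / w * (D * φ'' w) := by gcongr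
      _ = _ := by ring
  have hlim := tendsto_integral_cexp_saddle hA hβ (min_le_right _ _) hc.1 hx₀ hfpos hscal'
    hcont hΘre hcub
  have h2π : 0 < √(2 * π) := Real.sqrt_pos.2 (by positivity)
  have hlim' := ((Complex.continuous_re.tendsto _).comp hlim).div_const √(2 * π)
  rw [Complex.ofReal_re, div_self h2π.ne'] at hlim'
  have hev := hlim'.eventually (Metric.closedBall_mem_nhds 1 hε)
  rw [saddleFilter, eventually_inf_principal, eventually_comap] at hev
  obtain ⟨M, hM⟩ := eventually_atTop.1 hev
  refine ⟨max M 1, by positivity, fun t w ht hw htw => ?_⟩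
  have hw0 := hx₀.trans_lt hw
  have h := hM _ ((le_max_left M 1).trans htw.le) (t, w) rfl ⟨ht, hw⟩
  rw [Real.dist_eq] at h
  beta_reduce
  rw [fourierDensity_charExp_eq hm hfpos hβ hc.1 hx₀ hscal' hA hre ht hw0,
    saddle_normalization (ψ := fun ξ => laplaceC σ b ν (w + ξ * Complex.I)) (θ := Θ w) ht
      (hfpos w hw0) fun ξ => by simp only [hΘ]; ring]
  exact h

end
end

section
/- (Proposition 6) Suppose φ'' ∈ WLSC(α−2, c, x₀) for some c ∈ (0,1], x₀ ≥ 0 and α > 0. Then there is a constant C ≥ 1 such that for all 0 < r < 1/x₀ (with 1/x₀ = ∞ when x₀ = 0), K(r) ≤ h(r) ≤ C K(r). -/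
open MeasureTheory Real Set Filter

noncomputable section

lemma integrableOn_min_one_sq {ν : Measure ℝ}
    (hint : ∫⁻ x in Ioi (0:ℝ), ENNReal.ofReal (min 1 (x ^ 2)) ∂ν ≠ ⊤) :
    IntegrableOn (fun x : ℝ => min 1 (x ^ 2)) (Ioi 0) ν := by
  refine ⟨by fun_prop, ?_⟩
  rw [hasFiniteIntegral_iff_ofReal (ae_of_all _ fun x => by positivity)]
  exact hint.lt_top

/-- Functions on `(0,∞)` dominated by a multiple of `min 1 x²` are integrable. -/
lemma IntegrableOn.of_le_min_one_sq {ν : Measure ℝ}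
    (hm : IntegrableOn (fun x : ℝ => min 1 (x ^ 2)) (Ioi 0) ν) {s : Set ℝ} (hs : MeasurableSet s)
    (hs0 : s ⊆ Ioi 0) {g : ℝ → ℝ} (hg : Measurable g) (A : ℝ)
    (hA : ∀ x ∈ s, ‖g x‖ ≤ A * min 1 (x ^ 2)) : IntegrableOn g s ν :=
  ((hm.mono_set hs0).const_mul A).mono' hg.aestronglyMeasurable
    ((ae_restrict_iff' hs).2 (ae_of_all _ hA))

lemma integrableOn_sq_mul_exp {ν : Measure ℝ}
    (hm : IntegrableOn (fun x : ℝ => min 1 (x ^ 2)) (Ioi 0) ν) {l : ℝ} (hl : 0 < l) :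
    IntegrableOn (fun x : ℝ => x ^ 2 * Real.exp (-(l * x))) (Ioi 0) ν := by
  refine IntegrableOn.of_le_min_one_sq hm measurableSet_Ioi le_rfl (by fun_prop)
    (1 + 2 / l ^ 2) fun x hx => ?_
  have hx : 0 < x := hx
  have hlx : 0 < l * x := mul_pos hl hx
  have he : Real.exp (-(l * x)) ≤ 1 := Real.exp_le_one_iff.2 (by linarith)
  rw [Real.norm_of_nonneg (by positivity)]
  have hpos : (0:ℝ) < 2 / l ^ 2 := by positivity
  rcases le_total 1 (x ^ 2) with h | h
  · rw [min_eq_left h]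
    have hq := Real.quadratic_le_exp_of_nonneg hlx.le
    rw [Real.exp_neg]
    have : x ^ 2 * (Real.exp (l * x))⁻¹ ≤ 2 / l ^ 2 := by
      rw [← div_eq_mul_inv, div_le_div_iff₀ (Real.exp_pos _) (by positivity)]
      nlinarith
    linarith
  · rw [min_eq_right h]
    have : x ^ 2 * Real.exp (-(l * x)) ≤ x ^ 2 * 1 := by gcongr
    nlinarith [mul_nonneg hpos.le (sq_nonneg x)]

lemma integrableOn_min_one_sq_div {ν : Measure ℝ}
    (hm : IntegrableOn (fun x : ℝ => min 1 (x ^ 2)) (Ioi 0) ν) {r : ℝ} (hr : 0 < r) :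
    IntegrableOn (fun x : ℝ => min 1 (x ^ 2 / r ^ 2)) (Ioi 0) ν := by
  refine IntegrableOn.of_le_min_one_sq hm measurableSet_Ioi le_rfl (by fun_prop)
    (1 + 1 / r ^ 2) fun x _ => ?_
  rw [Real.norm_of_nonneg (by positivity)]
  have hpos : (0:ℝ) < 1 / r ^ 2 := by positivity
  rcases le_total 1 (x ^ 2) with h | h
  · rw [min_eq_left h]
    linarith [min_le_left 1 (x ^ 2 / r ^ 2)]
  · rw [min_eq_right h]
    have h2 := min_le_right 1 (x ^ 2 / r ^ 2)
    have : x ^ 2 / r ^ 2 = 1 / r ^ 2 * x ^ 2 := by ring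
    nlinarith [sq_nonneg x]

lemma integrableOn_sq_Ioo {ν : Measure ℝ}
    (hm : IntegrableOn (fun x : ℝ => min 1 (x ^ 2)) (Ioi 0) ν) (r : ℝ) :
    IntegrableOn (fun x : ℝ => x ^ 2) (Ioo 0 r) ν := by
  refine IntegrableOn.of_le_min_one_sq hm measurableSet_Ioo Ioo_subset_Ioi_self (by fun_prop)
    (1 + r ^ 2) fun x hx => ?_
  rw [Real.norm_of_nonneg (by positivity)]
  have : x ^ 2 ≤ r ^ 2 := pow_le_pow_left₀ hx.1.le hx.2.le 2
  rcases le_total 1 (x ^ 2) with h | h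
  · rw [min_eq_left h]; linarith
  · rw [min_eq_right h]; nlinarith [mul_nonneg (sq_nonneg r) (sq_nonneg x)]

lemma integrableOn_one_Ici {ν : Measure ℝ}
    (hm : IntegrableOn (fun x : ℝ => min 1 (x ^ 2)) (Ioi 0) ν) {r : ℝ} (hr : 0 < r) :
    IntegrableOn (fun _ : ℝ => (1:ℝ)) (Ici r) ν := by
  refine IntegrableOn.of_le_min_one_sq hm measurableSet_Ici (Ici_subset_Ioi.2 hr) (by fun_prop)
    (1 / min 1 (r ^ 2)) fun x hx => ?_
  have : min 1 (r ^ 2) ≤ min 1 (x ^ 2) :=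
    min_le_min le_rfl (pow_le_pow_left₀ hr.le hx 2)
  rw [norm_one, one_div_mul_eq_div, le_div_iff₀ (by positivity)]
  linarith

/-- The Pruitt function `h` is the sum of `K` and the tail of `ν`. -/
lemma pruittH_eq_pruittK_add (σ : ℝ) {ν : Measure ℝ}
    (hm : IntegrableOn (fun x : ℝ => min 1 (x ^ 2)) (Ioi 0) ν) {r : ℝ} (hr : 0 < r) :
    pruittH σ ν r = pruittK σ ν r + ∫ _ in Ici r, (1:ℝ) ∂ν := by
  have hi := integrableOn_min_one_sq_div hm hr
  have hU : Ioi (0:ℝ) = Ioo 0 r ∪ Ici r := (Ioo_union_Ici_eq_Ioi hr).symm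
  have hd : Disjoint (Ioo (0:ℝ) r) (Ici r) :=
    Set.disjoint_left.2 fun x hx hx' => absurd hx.2 (not_lt.2 hx')
  unfold pruittH pruittK
  rw [hU, setIntegral_union hd measurableSet_Ici (hi.mono_set Ioo_subset_Ioi_self)
    (hi.mono_set (Ici_subset_Ioi.2 hr)), ← integral_div, add_assoc]
  congr 2
  · refine setIntegral_congr_fun measurableSet_Ioo fun x hx => min_eq_right ?_
    rw [div_le_one (by positivity)]
    exact pow_le_pow_left₀ hx.1.le hx.2.le 2
  · refine setIntegral_congr_fun measurableSet_Ici fun x hx => min_eq_left ?_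
    rw [one_le_div (by positivity)]
    exact pow_le_pow_left₀ hr.le hx 2

lemma integral_one_Ici_anti {ν : Measure ℝ}
    (hm : IntegrableOn (fun x : ℝ => min 1 (x ^ 2)) (Ioi 0) ν) {r R : ℝ} (hr : 0 < r)
    (h : r ≤ R) : ∫ _ in Ici R, (1:ℝ) ∂ν ≤ ∫ _ in Ici r, (1:ℝ) ∂ν :=
  setIntegral_mono_set (integrableOn_one_Ici hm hr) (ae_of_all _ fun _ => zero_le_one)
    (Ici_subset_Ici.2 h).eventuallyLE

lemma tendsto_integral_one_Ici {ν : Measure ℝ}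
    (hm : IntegrableOn (fun x : ℝ => min 1 (x ^ 2)) (Ioi 0) ν) :
    Tendsto (fun R : ℝ => ∫ _ in Ici R, (1:ℝ) ∂ν) atTop (nhds 0) := by
  have h := tendsto_setIntegral_of_antitone (μ := ν) (s := fun R : ℝ => Ici R)
    (f := fun _ : ℝ => (1:ℝ)) (fun _ => measurableSet_Ici) (fun _ _ h => Ici_subset_Ici.2 h)
    ⟨1, integrableOn_one_Ici hm one_pos⟩
  have he : ⋂ R : ℝ, Ici R = ∅ := by
    refine eq_empty_of_forall_notMem fun x hx => ?_
    have := mem_iInter.1 hx (x + 1)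
    rw [mem_Ici] at this
    linarith
  simpa [he] using h

/-- The tail of `ν` over `[r, M r)` is controlled by the Laplace transform of `x² ν(dx)`. -/
lemma integral_one_Ici_le {ν : Measure ℝ}
    (hm : IntegrableOn (fun x : ℝ => min 1 (x ^ 2)) (Ioi 0) ν) {r M : ℝ} (hr : 0 < r)
    (hM : 1 ≤ M) :
    ∫ _ in Ici r, (1:ℝ) ∂ν ≤ (∫ _ in Ici (M * r), (1:ℝ) ∂ν) +
      Real.exp M * ((∫ x in Ioi (0:ℝ), x ^ 2 * Real.exp (-(1 / r * x)) ∂ν) / r ^ 2) := by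
  have hrM : r ≤ M * r := le_mul_of_one_le_left hr.le hM
  have h1 := integrableOn_one_Ici hm hr
  have h2 := integrableOn_sq_mul_exp hm (one_div_pos.2 hr)
  have hd : Disjoint (Ico r (M * r)) (Ici (M * r)) :=
    Set.disjoint_left.2 fun x hx hx' => absurd hx.2 (not_lt.2 hx')
  have hsub : Ico r (M * r) ⊆ Ioi 0 := fun x hx => hr.trans_le hx.1
  rw [← Ico_union_Ici_eq_Ici hrM, setIntegral_union hd measurableSet_Ici
    (h1.mono_set Ico_subset_Ici_self) (h1.mono_set (Ici_subset_Ici.2 hrM)), add_comm]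
  refine add_le_add le_rfl ?_
  rw [← integral_div, ← integral_const_mul]
  have h3 := (h2.div_const (r ^ 2)).const_mul (Real.exp M)
  refine (setIntegral_mono_on (h1.mono_set Ico_subset_Ici_self) (h3.mono_measure
    (Measure.restrict_mono hsub le_rfl)) measurableSet_Ico fun x hx => ?_).trans
    (setIntegral_mono_set h3 (ae_of_all _ fun x => by positivity) hsub.eventuallyLE)
  have e1 : 1 ≤ x ^ 2 / r ^ 2 := by
    rw [one_le_div (by positivity)]
    exact pow_le_pow_left₀ hr.le hx.1 2
  have e2 : 1 ≤ Real.exp M * Real.exp (-(1 / r * x)) := by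
    rw [← Real.exp_add, Real.one_le_exp_iff]
    have : x / r ≤ M := (div_le_iff₀ hr).2 hx.2.le
    have : 1 / r * x = x / r := by ring
    linarith
  calc (1:ℝ) ≤ (x ^ 2 / r ^ 2) * (Real.exp M * Real.exp (-(1 / r * x))) :=
        one_le_mul_of_one_le_of_one_le e1 e2
    _ = _ := by ring

/-- Truncating the Laplace transform of `x² ν(dx)` at `r` costs an exponentially small factor. -/
lemma integral_sq_mul_exp_le {ν : Measure ℝ}
    (hm : IntegrableOn (fun x : ℝ => min 1 (x ^ 2)) (Ioi 0) ν) {r l : ℝ} (hr : 0 < r)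
    (hl : 1 ≤ l) :
    ∫ x in Ioi (0:ℝ), x ^ 2 * Real.exp (-(l * (1 / r) * x)) ∂ν ≤
      (∫ x in Ioo (0:ℝ) r, x ^ 2 ∂ν) +
      Real.exp (-(l - 1)) * ∫ x in Ioi (0:ℝ), x ^ 2 * Real.exp (-(1 / r * x)) ∂ν := by
  have hl0 : 0 < l := by linarith
  have h1 := integrableOn_sq_mul_exp hm (mul_pos hl0 (one_div_pos.2 hr))
  have h2 := (integrableOn_sq_mul_exp hm (one_div_pos.2 hr)).const_mul (Real.exp (-(l - 1)))
  have hU : Ioi (0:ℝ) = Ioo 0 r ∪ Ici r := (Ioo_union_Ici_eq_Ioi hr).symm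
  have hd : Disjoint (Ioo (0:ℝ) r) (Ici r) :=
    Set.disjoint_left.2 fun x hx hx' => absurd hx.2 (not_lt.2 hx')
  have hs : Ici r ⊆ Ioi 0 := Ici_subset_Ioi.2 hr
  have hL : ∫ x in Ioi (0:ℝ), x ^ 2 * Real.exp (-(l * (1 / r) * x)) ∂ν =
      (∫ x in Ioo (0:ℝ) r, x ^ 2 * Real.exp (-(l * (1 / r) * x)) ∂ν) +
      ∫ x in Ici r, x ^ 2 * Real.exp (-(l * (1 / r) * x)) ∂ν := by
    rw [hU, setIntegral_union hd measurableSet_Ici (h1.mono_set Ioo_subset_Ioi_self)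
      (h1.mono_set hs)]
  rw [hL, ← integral_const_mul]
  refine add_le_add ?_ ?_
  · refine setIntegral_mono_on (h1.mono_set Ioo_subset_Ioi_self) (integrableOn_sq_Ioo hm r)
      measurableSet_Ioo fun x hx => mul_le_of_le_one_right (sq_nonneg x) ?_
    have := hx.1
    rw [Real.exp_le_one_iff, neg_nonpos]
    positivity
  · refine (setIntegral_mono_on (h1.mono_set hs) (h2.mono_measure
      (Measure.restrict_mono hs le_rfl)) measurableSet_Ici fun x hx => ?_).trans
      (setIntegral_mono_set h2 (ae_of_all _ fun x => by positivity) hs.eventuallyLE)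
    have hx1 : 1 ≤ x / r := (one_le_div hr).2 hx
    have : Real.exp (-(l * (1 / r) * x)) ≤ Real.exp (-(l - 1)) * Real.exp (-(1 / r * x)) := by
      rw [← Real.exp_add, Real.exp_le_exp]
      have e1 : l * (1 / r) * x = l * (x / r) := by ring
      have e2 : 1 / r * x = x / r := by ring
      rw [e1, e2]
      nlinarith
    calc x ^ 2 * Real.exp (-(l * (1 / r) * x))
        ≤ x ^ 2 * (Real.exp (-(l - 1)) * Real.exp (-(1 / r * x))) := by gcongr
      _ = _ := by ring

/-- If the Laplace transform of `x² ν(dx)` vanishes then so do the tails of `ν`. -/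
lemma integral_one_Ici_eq_zero {ν : Measure ℝ}
    (hm : IntegrableOn (fun x : ℝ => min 1 (x ^ 2)) (Ioi 0) ν) {l : ℝ} (hl : 0 < l)
    (h : ∫ x in Ioi (0:ℝ), x ^ 2 * Real.exp (-(l * x)) ∂ν = 0) {R : ℝ} (hR : 0 < R) :
    ∫ _ in Ici R, (1:ℝ) ∂ν = 0 := by
  rw [setIntegral_eq_zero_iff_of_nonneg_ae (ae_of_all _ fun x => by positivity)
    (integrableOn_sq_mul_exp hm hl)] at h
  have hF : ∀ᵐ x ∂ν.restrict (Ici R), False := by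
    filter_upwards [ae_restrict_of_ae_restrict_of_subset (Ici_subset_Ioi.2 hR) h,
      ae_restrict_mem measurableSet_Ici] with x hx hx'
    have : 0 < x := hR.trans_le hx'
    have : 0 < x ^ 2 * Real.exp (-(l * x)) := by positivity
    exact this.ne' hx
  have hz : ν.restrict (Ici R) = 0 := by
    rwa [← ae_eq_bot, ← Filter.eventually_false_iff_eq_bot]
  rw [hz, integral_zero_measure]

/-- Iteration along a geometric sequence: if `G r ≤ G (M r) + B D(r)` and `D`
at least halves along `r ↦ M r` below `R`, then `G ≤ 2 B D + G R`. -/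
lemma le_two_mul_add_of_geometric {G D : ℝ → ℝ} {M B R : ℝ} (hM : 1 < M) (hB : 0 ≤ B)
    (hGanti : ∀ r, R ≤ r → G r ≤ G R) (hD : ∀ r, 0 < r → 0 ≤ D r)
    (hG : ∀ r, 0 < r → G r ≤ G (M * r) + B * D r)
    (hhalf : ∀ r, 0 < r → r < R → 2 * D (M * r) ≤ D r) {r : ℝ} (hr : 0 < r) :
    G r ≤ 2 * B * D r + G R := by
  have key : ∀ n : ℕ, ∀ r, 0 < r → R ≤ M ^ n * r → G r ≤ 2 * B * D r + G R := by
    intro n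
    induction n with
    | zero =>
      intro r hr h
      have := hGanti r (by simpa using h)
      have := mul_nonneg hB (hD r hr)
      linarith
    | succ n ih =>
      intro r hr h
      rcases le_or_gt R r with h' | h'
      · have := hGanti r h'
        have := mul_nonneg hB (hD r hr)
        linarith
      · have h1 := ih (M * r) (by positivity) (by rw [pow_succ] at h; linarith)
        have h2 := hG r hr
        have h3 := mul_le_mul_of_nonneg_left (hhalf r hr h') hB
        linarith
  obtain ⟨n, hn⟩ := pow_unbounded_of_one_lt (R / r) hM
  exact key n r hr ((div_lt_iff₀ hr).1 hn).le

/-- Proposition 6. -/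
theorem statement11
    (ν : Measure ℝ) [SigmaFinite ν]
    (hint : ∫⁻ x in Ioi (0:ℝ), ENNReal.ofReal (min 1 (x ^ 2)) ∂ν ≠ ⊤)
    (σ b : ℝ) (hσ : 0 ≤ σ)
    (φ φ' φ'' : ℝ → ℝ)
    (hφ : ∀ l : ℝ, 0 ≤ l → φ l = σ ^ 2 * l ^ 2 - b * l +
      ∫ x in Ioi (0:ℝ), (Real.exp (-(l * x)) - 1 + l * x * (if x < 1 then 1 else 0)) ∂ν)
    (hD1 : ∀ x : ℝ, 0 < x → HasDerivAt φ (φ' x) x)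
    (hD2 : ∀ x : ℝ, 0 < x → HasDerivAt φ' (φ'' x) x)
    (hφ'' : ∀ l : ℝ, 0 < l → φ'' l = 2 * σ ^ 2 + ∫ x in Ioi (0:ℝ), x ^ 2 * Real.exp (-(l * x)) ∂ν)
    (α c x₀ : ℝ) (hα : 0 < α) (hc : c ∈ Ioc (0:ℝ) 1) (hx₀ : 0 ≤ x₀)
    (hscal : WLSC φ'' (α - 2) c x₀) :
    ∃ C : ℝ, 1 ≤ C ∧ ∀ r : ℝ, 0 < r → r * x₀ < 1 →
      pruittK σ ν r ≤ pruittH σ ν r ∧ pruittH σ ν r ≤ C * pruittK σ ν r := by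
  have hm := integrableOn_min_one_sq hint
  obtain ⟨hc0, hc1⟩ := hc
  set J : ℝ → ℝ := fun l => ∫ x in Ioi (0:ℝ), x ^ 2 * Real.exp (-(l * x)) ∂ν
  set G : ℝ → ℝ := fun r => ∫ _ in Ici r, (1:ℝ) ∂ν
  set D : ℝ → ℝ := fun r => φ'' (1 / r) / r ^ 2 with hDdef
  have hJ0 : ∀ l, 0 ≤ J l := fun l => integral_nonneg fun x => by positivity
  have hG0 : ∀ r, 0 ≤ G r := fun r => integral_nonneg fun x => zero_le_one
  have hφJ : ∀ l, 0 < l → φ'' l = 2 * σ ^ 2 + J l := hφ''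
  have hφ0 : ∀ l, 0 < l → 0 ≤ φ'' l := fun l hl => by
    rw [hφJ l hl]; have := hJ0 l; positivity
  have hD0 : ∀ r, 0 < r → 0 ≤ D r := fun r hr => div_nonneg (hφ0 _ (by positivity)) (by positivity)
  have hφanti : ∀ x y, 0 < x → x ≤ y → φ'' y ≤ φ'' x := fun x y hx hxy => by
    rw [hφJ x hx, hφJ y (hx.trans_le hxy)]
    refine add_le_add le_rfl (setIntegral_mono_on (integrableOn_sq_mul_exp hm (hx.trans_le hxy))
      (integrableOn_sq_mul_exp hm hx) measurableSet_Ioi fun t ht => ?_)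
    have ht : 0 < t := ht
    gcongr
  have hlt : ∀ r, 0 < r → r * x₀ < 1 → x₀ < 1 / r := fun r hr h => by
    rw [lt_div_iff₀ hr]; linarith
  have hK0 : ∀ r, 0 < r → 0 ≤ pruittK σ ν r := fun r hr => by
    have : 0 ≤ ∫ s in Ioo (0:ℝ) r, s ^ 2 ∂ν := integral_nonneg fun x => by positivity
    unfold pruittK; positivity
  obtain ⟨A, hA0, hA⟩ : ∃ A : ℝ, 0 ≤ A ∧ ∀ r, 0 < r → r * x₀ < 1 → D r ≤ A * pruittK σ ν r := by
    have ht : ∀ᶠ l : ℝ in atTop, l ^ (2 - α) * Real.exp (-1 * l) < c / (2 * Real.exp 1) :=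
      (tendsto_rpow_mul_exp_neg_mul_atTop_nhds_zero (2 - α) 1 one_pos).eventually_lt_const
        (by positivity)
    obtain ⟨l, hl, hl1⟩ := (ht.and (eventually_ge_atTop 1)).exists
    have hl0 : 0 < l := by linarith
    set p := l ^ (α - 2) with hp
    have hp0 : 0 < p := Real.rpow_pos_of_pos hl0 _
    have hle : 2 * Real.exp (-(l - 1)) ≤ c * p := by
      have h1 : l ^ (2 - α) * p = 1 := by
        rw [hp, ← Real.rpow_add hl0]; simp
      have h2 : Real.exp (-(l - 1)) = Real.exp 1 * Real.exp (-1 * l) := by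
        rw [← Real.exp_add]; congr 1; ring
      rw [lt_div_iff₀ (by positivity)] at hl
      have h3 := mul_le_mul_of_nonneg_right hl.le hp0.le
      calc 2 * Real.exp (-(l - 1)) = (l ^ (2 - α) * p) * (2 * Real.exp (-(l - 1))) := by
            rw [h1, one_mul]
        _ = l ^ (2 - α) * Real.exp (-1 * l) * (2 * Real.exp 1) * p := by rw [h2]; ring
        _ ≤ c * p := h3
    refine ⟨4 / (c * p), by positivity, fun r hr hrx => ?_⟩
    have hr1 : 0 < 1 / r := one_div_pos.2 hr
    have hs := hscal l hl1 (1 / r) (hlt r hr hrx)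
    rw [hφJ (l * (1 / r)) (by positivity)] at hs
    have ht := integral_sq_mul_exp_le hm hr hl1
    have hJφ : J (1 / r) ≤ φ'' (1 / r) := by
      rw [hφJ _ hr1]; nlinarith [sq_nonneg σ]
    set I := ∫ s in Ioo (0:ℝ) r, s ^ 2 ∂ν
    have hI0 : 0 ≤ I := integral_nonneg fun x => by positivity
    have hK : pruittK σ ν r = (σ ^ 2 + I) / r ^ 2 := by
      rw [add_div]; rfl
    have h5 : J (l * (1 / r)) ≤ I + Real.exp (-(l - 1)) * φ'' (1 / r) :=
      ht.trans (add_le_add le_rfl (mul_le_mul_of_nonneg_left hJφ (Real.exp_pos _).le))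
    have h6 := mul_le_mul_of_nonneg_right hle (hφ0 _ hr1)
    have h7 : c * p * φ'' (1 / r) ≤ 4 * (σ ^ 2 + I) := by
      nlinarith [sq_nonneg σ]
    rw [hK, ← mul_div_assoc]
    refine div_le_div_of_nonneg_right ?_ (by positivity)
    rw [div_mul_eq_mul_div, le_div_iff₀ (by positivity)]
    linarith
  obtain ⟨M, hM2, hM1⟩ : ∃ M : ℝ, 2 / c ≤ M ^ α ∧ 1 < M :=
    (((tendsto_rpow_atTop hα).eventually_ge_atTop (2 / c)).and (eventually_gt_atTop 1)).exists
  have hM0 : 0 < M := by linarith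
  have hstep : ∀ r, 0 < r → G r ≤ G (M * r) + Real.exp M * D r := fun r hr => by
    refine (integral_one_Ici_le hm hr hM1.le).trans ?_
    refine add_le_add le_rfl (mul_le_mul_of_nonneg_left ?_ (Real.exp_pos M).le)
    refine div_le_div_of_nonneg_right ?_ (by positivity)
    rw [hφJ _ (one_div_pos.2 hr)]
    exact le_add_of_nonneg_left (by positivity)
  have hhalf : ∀ r, 0 < r → M * r * x₀ < 1 → 2 * D (M * r) ≤ D r := fun r hr h => by
    have hs := hscal M hM1.le (1 / (M * r)) (hlt _ (by positivity) h)
    have e1 : M * (1 / (M * r)) = 1 / r := by field_simp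
    have e2 : M ^ (α - 2) = M ^ α / M ^ 2 := by
      rw [Real.rpow_sub hM0]; norm_num
    rw [e1, e2] at hs
    have hc2 : 2 ≤ c * M ^ α := by
      rw [div_le_iff₀ hc0] at hM2; linarith
    have hφ1 := hφ0 (1 / (M * r)) (by positivity)
    calc 2 * D (M * r) ≤ c * M ^ α * D (M * r) :=
          mul_le_mul_of_nonneg_right hc2 (hD0 _ (by positivity))
      _ = c * (M ^ α / M ^ 2) * φ'' (1 / (M * r)) / r ^ 2 := by
          simp only [hDdef]; field_simp
      _ ≤ D r := div_le_div_of_nonneg_right hs (by positivity)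
  have hrec : ∀ R, 0 < R → (∀ r, 0 < r → r < R → M * r * x₀ < 1) → ∀ r, 0 < r →
      G r ≤ 2 * Real.exp M * D r + G R := fun R hR h r hr =>
    le_two_mul_add_of_geometric (G := G) hM1 (Real.exp_pos M).le
      (fun s hs => integral_one_Ici_anti hm hR hs) hD0 hstep
      (fun s hs hs' => hhalf s hs (h s hs hs')) hr
  obtain ⟨B, hB0, hB⟩ : ∃ B : ℝ, 0 ≤ B ∧ ∀ r, 0 < r → r * x₀ < 1 → G r ≤ B * D r := by
    rcases hx₀.eq_or_lt with rfl | hx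
    · refine ⟨2 * Real.exp M, by positivity, fun r hr _ => ?_⟩
      have ht := (tendsto_integral_one_Ici hm).const_add (2 * Real.exp M * D r)
      rw [add_zero] at ht
      refine ge_of_tendsto ht ?_
      filter_upwards [eventually_gt_atTop 0] with R hR
      exact hrec R hR (fun _ _ _ => by simp) r hr
    · have hlow : ∀ r, 0 < r → r * x₀ < 1 → c * x₀ ^ 2 * φ'' (2 * x₀) ≤ D r := by
        intro r hr hrx
        have hy := hlt r hr hrx
        set y := 1 / r with hydef
        have hy0 : 0 < y := one_div_pos.2 hr
        have hDy : D r = y ^ 2 * φ'' y := by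
          simp only [hDdef, hydef]; field_simp
        rw [hDy]
        have hφ2 := hφ0 (2 * x₀) (by positivity)
        rcases le_total y (2 * x₀) with h | h
        · have h1 := hφanti y (2 * x₀) hy0 h
          have h2 : x₀ ^ 2 ≤ y ^ 2 := pow_le_pow_left₀ hx.le hy.le 2
          calc c * x₀ ^ 2 * φ'' (2 * x₀) ≤ 1 * x₀ ^ 2 * φ'' (2 * x₀) := by gcongr
            _ ≤ y ^ 2 * φ'' y := by rw [one_mul]; gcongr
        · set l := y / (2 * x₀) with hl
          have hl1 : 1 ≤ l := (one_le_div (by positivity)).2 h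
          have hl0 : 0 < l := by linarith
          have hs := hscal l hl1 (2 * x₀) (by linarith)
          have e1 : l * (2 * x₀) = y := div_mul_cancel₀ _ (by positivity)
          have e2 : l ^ (α - 2) = l ^ α / l ^ 2 := by
            rw [Real.rpow_sub hl0]; norm_num
          have h1 : 1 ≤ l ^ α := Real.one_le_rpow hl1 hα.le
          rw [e1, e2] at hs
          have hq : 0 ≤ c * x₀ ^ 2 * φ'' (2 * x₀) := by positivity
          calc c * x₀ ^ 2 * φ'' (2 * x₀) ≤ 4 * l ^ α * (c * x₀ ^ 2 * φ'' (2 * x₀)) :=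
                le_mul_of_one_le_left hq (by linarith)
            _ = y ^ 2 * (c * (l ^ α / l ^ 2) * φ'' (2 * x₀)) := by
                rw [← e1]; field_simp; ring
            _ ≤ y ^ 2 * φ'' y := by gcongr
      have hR : 0 < 1 / (M * x₀) := by positivity
      obtain ⟨E, hE0, hE⟩ : ∃ E : ℝ, 0 ≤ E ∧ G (1 / (M * x₀)) ≤ E * φ'' (2 * x₀) := by
        rcases (hφ0 (2 * x₀) (by positivity)).eq_or_lt with h0 | h0
        · refine ⟨0, le_rfl, ?_⟩
          have hJz : J (2 * x₀) = 0 := by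
            have := hφJ (2 * x₀) (by positivity)
            nlinarith [sq_nonneg σ, hJ0 (2 * x₀)]
          rw [zero_mul]
          exact (integral_one_Ici_eq_zero hm (by positivity) hJz hR).le
        · exact ⟨_, div_nonneg (hG0 _) h0.le, (div_mul_cancel₀ _ h0.ne').ge⟩
      refine ⟨2 * Real.exp M + E / (c * x₀ ^ 2), by positivity, fun r hr hrx => ?_⟩
      have h1 := hrec _ hR (fun s hs hs' => by
        rw [lt_div_iff₀ (by positivity)] at hs'; linarith) r hr
      have h2 : E * φ'' (2 * x₀) ≤ E / (c * x₀ ^ 2) * D r := by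
        calc E * φ'' (2 * x₀) = E / (c * x₀ ^ 2) * (c * x₀ ^ 2 * φ'' (2 * x₀)) := by field_simp
          _ ≤ _ := mul_le_mul_of_nonneg_left (hlow r hr hrx) (by positivity)
      linarith
  refine ⟨1 + B * A, le_add_of_nonneg_right (by positivity), fun r hr hrx => ?_⟩
  rw [pruittH_eq_pruittK_add σ hm hr]
  refine ⟨le_add_of_nonneg_right (hG0 r), ?_⟩
  have h1 := hB r hr hrx
  have h2 := mul_le_mul_of_nonneg_left (hA r hr hrx) hB0
  calc pruittK σ ν r + G r ≤ pruittK σ ν r + B * (A * pruittK σ ν r) := by linarith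
    _ = _ := by ring

end
end

section
/- (Corollary 5) One has φ'' ∈ WLSC(α−2, c, x₀) for some c ∈ (0,1], x₀ ≥ 0 and α > 0 if and only if the function ξ ↦ Re ψ(ξ) belongs to WLSC(α, c̃, x₀) for some c̃ ∈ (0,1] (with the same α and x₀). -/
open MeasureTheory Real Set Filter

noncomputable section

/-- A nonnegative measurable function on `(0,∞)` dominated by a multiple of `min 1 u²`. -/
structure IsLevyKernel (g : ℝ → ℝ) : Prop where
  measurable : Measurable g
  nonneg : ∀ u, 0 < u → 0 ≤ g u
  bound : ∃ C, 0 ≤ C ∧ ∀ u, 0 < u → g u ≤ C * min 1 (u ^ 2)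

/-- The transform `x ↦ v a x² + ∫ g(xs) μ(ds)` of the Lévy pair `(v, μ)` with kernel `g`
and Gaussian weight `a`. -/
def levyTransform (μ : Measure ℝ) (v a : ℝ) (g : ℝ → ℝ) (x : ℝ) : ℝ :=
  v * a * x ^ 2 + ∫ s, g (x * s) ∂μ

/-- The Pruitt kernel `min(1, u²)`. -/
def truncSq (u : ℝ) : ℝ := min 1 (u ^ 2)

/-- The kernel `u² 1_{u<1}`. -/
def smallSq (u : ℝ) : ℝ := if u < 1 then u ^ 2 else 0

/-- The kernel `u² e^{-u}`. -/
def sqExp (u : ℝ) : ℝ := u ^ 2 * Real.exp (-u)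

/-- The kernel `1 - cos u`. -/
def oneSubCos (u : ℝ) : ℝ := 1 - Real.cos u

lemma sqExp_le_truncSq {u : ℝ} (hu : 0 < u) : sqExp u ≤ 2 * truncSq u := by
  have h1 := Real.quadratic_le_exp_of_nonneg hu.le
  have h2 : Real.exp (-u) * Real.exp u = 1 := by rw [← Real.exp_add]; simp
  have h3 : Real.exp (-u) ≤ 1 := by simpa using hu.le
  have h4 := Real.exp_pos (-u)
  unfold sqExp truncSq
  rcases min_cases 1 (u ^ 2) with h | h <;> rw [h.1]
  · nlinarith
  · nlinarith [sq_nonneg u]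

lemma oneSubCos_le_truncSq (u : ℝ) : oneSubCos u ≤ 2 * truncSq u := by
  have h1 := Real.one_sub_sq_div_two_le_cos (x := u)
  have h2 := Real.neg_one_le_cos u
  unfold oneSubCos truncSq
  rcases min_cases 1 (u ^ 2) with h | h <;> rw [h.1] <;> nlinarith [sq_nonneg u]

lemma sq_div_five_le_oneSubCos {u : ℝ} (h0 : 0 ≤ u) (h3 : u ≤ 3) :
    u ^ 2 / 5 ≤ oneSubCos u := by
  have hpi := Real.pi_gt_three
  have hpi' := Real.pi_lt_d2
  have h := Real.cos_le_one_sub_mul_cos_sq (x := u) (by rw [abs_of_nonneg h0]; linarith)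
  have h5 : (1 : ℝ) / 5 ≤ 2 / Real.pi ^ 2 := by
    rw [div_le_div_iff₀ (by norm_num) (by positivity)]; nlinarith
  unfold oneSubCos
  nlinarith [mul_le_mul_of_nonneg_right h5 (sq_nonneg u)]

lemma isLevyKernel_truncSq : IsLevyKernel truncSq where
  measurable := by unfold truncSq; fun_prop
  nonneg u _ := le_min zero_le_one (sq_nonneg u)
  bound := ⟨1, zero_le_one, fun u _ => by simp [truncSq]⟩

lemma isLevyKernel_smallSq : IsLevyKernel smallSq where
  measurable := Measurable.ite measurableSet_Iio (by fun_prop) measurable_const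
  nonneg u _ := by unfold smallSq; split_ifs <;> positivity
  bound := ⟨1, zero_le_one, fun u hu => by
    unfold smallSq
    split_ifs with h
    · rw [one_mul]; exact le_min (by nlinarith) le_rfl
    · positivity⟩

lemma isLevyKernel_sqExp : IsLevyKernel sqExp where
  measurable := by unfold sqExp; fun_prop
  nonneg u _ := by unfold sqExp; positivity
  bound := ⟨2, zero_le_two, fun _ hu => sqExp_le_truncSq hu⟩

lemma isLevyKernel_oneSubCos : IsLevyKernel oneSubCos where
  measurable := by unfold oneSubCos; fun_prop
  nonneg u _ := by unfold oneSubCos; linarith [Real.cos_le_one u]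
  bound := ⟨2, zero_le_two, fun u _ => oneSubCos_le_truncSq u⟩

/-- The average of `1 - cos` over dilations in `[1, 4]` controls `min(1, u²)`. -/
lemma truncSq_le_integral_oneSubCos {u : ℝ} (hu : 0 < u) :
    truncSq u ≤ 3 * ∫ t in (1 : ℝ)..4, oneSubCos (t * u) := by
  rcases le_total u (3 / 4) with h | h
  · have h1 : ∫ _ in (1 : ℝ)..4, u ^ 2 / 5 ≤ ∫ t in (1 : ℝ)..4, oneSubCos (t * u) := by
      refine intervalIntegral.integral_mono_on (by norm_num) (by simp) ?_ ?_
      · apply Continuous.intervalIntegrable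
        unfold oneSubCos
        fun_prop
      · intro t ht
        have h2 := sq_div_five_le_oneSubCos (u := t * u) (by nlinarith [ht.1]) (by nlinarith [ht.2])
        have : u ^ 2 ≤ (t * u) ^ 2 := by
          gcongr
          nlinarith [ht.1]
        linarith
    rw [intervalIntegral.integral_const] at h1
    have h2 : truncSq u ≤ u ^ 2 := min_le_right _ _
    have : 3 * (u ^ 2 / 5) ≤ ∫ t in (1 : ℝ)..4, oneSubCos (t * u) := by
      refine le_trans (le_of_eq ?_) h1
      rw [smul_eq_mul]; ring
    nlinarith [sq_nonneg u]
  · have h1 : ∫ t in (1 : ℝ)..4, oneSubCos (t * u)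
        = 3 - u⁻¹ * (Real.sin (4 * u) - Real.sin u) := by
      unfold oneSubCos
      rw [intervalIntegral.integral_sub (by simp)
        (by apply Continuous.intervalIntegrable; fun_prop),
        intervalIntegral.integral_comp_mul_right (fun t => Real.cos t) hu.ne']
      simp
      norm_num
    have h2 : truncSq u ≤ 1 := min_le_left _ _
    have h3 : u⁻¹ ≤ 4 / 3 := by
      rw [inv_le_comm₀ hu (by norm_num)]; norm_num; linarith
    have h4 := Real.sin_le_one (4 * u)
    have h5 := Real.neg_one_le_sin u
    have h6 : 0 < u⁻¹ := by positivity
    rw [h1]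
    nlinarith

section Transform

variable {μ : Measure ℝ} {v : ℝ}

lemma IsLevyKernel.integrable {g : ℝ → ℝ} (hg : IsLevyKernel g) (hpos : ∀ᵐ s ∂μ, 0 < s)
    (hμ : Integrable truncSq μ) {x : ℝ} (hx : 0 < x) : Integrable (fun s => g (x * s)) μ := by
  obtain ⟨C, hC, hb⟩ := hg.bound
  refine (hμ.const_mul (C * (1 + x ^ 2))).mono'
    ((hg.measurable.comp (measurable_const_mul x)).aestronglyMeasurable) ?_
  filter_upwards [hpos] with s hs
  rw [Real.norm_of_nonneg (hg.nonneg _ (mul_pos hx hs)), mul_assoc]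
  refine (hb _ (mul_pos hx hs)).trans (mul_le_mul_of_nonneg_left ?_ hC)
  unfold truncSq
  rcases min_cases 1 (s ^ 2) with h | h <;> rw [h.1]
  · exact (min_le_left _ _).trans (by nlinarith [sq_nonneg x])
  · exact (min_le_right _ _).trans (by nlinarith [sq_nonneg s])

lemma levyTransform_nonneg {g : ℝ → ℝ} (hg : IsLevyKernel g) (hpos : ∀ᵐ s ∂μ, 0 < s)
    (hv : 0 ≤ v) {a : ℝ} (ha : 0 ≤ a) {x : ℝ} (hx : 0 < x) : 0 ≤ levyTransform μ v a g x := by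
  refine add_nonneg (by positivity) (integral_nonneg_of_ae ?_)
  filter_upwards [hpos] with s hs
  exact hg.nonneg _ (mul_pos hx hs)

/-- Pointwise comparison of kernels gives comparison of transforms. -/
lemma levyTransform_le {g g₁ g₂ : ℝ → ℝ} (hg : IsLevyKernel g) (hg₁ : IsLevyKernel g₁)
    (hg₂ : IsLevyKernel g₂) (hpos : ∀ᵐ s ∂μ, 0 < s) (hμ : Integrable truncSq μ) (hv : 0 ≤ v)
    {a a₁ a₂ A B k l m : ℝ} (hk : 0 < k) (hl : 0 < l) (hm : 0 < m)
    (ha : a * k ^ 2 ≤ A * (a₁ * l ^ 2) + B * (a₂ * m ^ 2))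
    (h : ∀ u, 0 < u → g (k * u) ≤ A * g₁ (l * u) + B * g₂ (m * u)) {x : ℝ} (hx : 0 < x) :
    levyTransform μ v a g (k * x) ≤
      A * levyTransform μ v a₁ g₁ (l * x) + B * levyTransform μ v a₂ g₂ (m * x) := by
  have i₁ := (hg₁.integrable hpos hμ (mul_pos hl hx)).const_mul A
  have i₂ := (hg₂.integrable hpos hμ (mul_pos hm hx)).const_mul B
  have key : ∫ s, g (k * x * s) ∂μ ≤
      A * ∫ s, g₁ (l * x * s) ∂μ + B * ∫ s, g₂ (m * x * s) ∂μ := by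
    rw [← integral_const_mul, ← integral_const_mul, ← integral_add i₁ i₂]
    refine integral_mono_ae (hg.integrable hpos hμ (mul_pos hk hx)) (i₁.add i₂) ?_
    filter_upwards [hpos] with s hs
    have := h (x * s) (mul_pos hx hs)
    simpa only [Pi.add_apply, mul_assoc] using this
  have hvx : 0 ≤ v * x ^ 2 := by positivity
  have := mul_le_mul_of_nonneg_left ha hvx
  unfold levyTransform
  nlinarith

/-- The single-kernel form of `levyTransform_le`. -/
lemma levyTransform_le_mul {g g₁ : ℝ → ℝ} (hg : IsLevyKernel g) (hg₁ : IsLevyKernel g₁)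
    (hpos : ∀ᵐ s ∂μ, 0 < s) (hμ : Integrable truncSq μ) (hv : 0 ≤ v)
    {a a₁ A k : ℝ} (hk : 0 < k) (ha : a * k ^ 2 ≤ A * a₁)
    (h : ∀ u, 0 < u → g (k * u) ≤ A * g₁ u) {x : ℝ} (hx : 0 < x) :
    levyTransform μ v a g (k * x) ≤ A * levyTransform μ v a₁ g₁ x := by
  simpa using levyTransform_le hg hg₁ hg₁ hpos hμ hv (a := a) (a₁ := a₁) (a₂ := 0) (A := A)
    (B := 0) hk one_pos one_pos (by simpa using ha) (by simpa using h) hx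

lemma smallSq_transform_le_sqExp (hpos : ∀ᵐ s ∂μ, 0 < s) (hμ : Integrable truncSq μ)
    (hv : 0 ≤ v) {x : ℝ} (hx : 0 < x) :
    levyTransform μ v 1 smallSq x ≤ 3 * levyTransform μ v 2 sqExp x := by
  simpa using levyTransform_le_mul isLevyKernel_smallSq isLevyKernel_sqExp hpos hμ hv
    (a := 1) (a₁ := 2) (A := 3) one_pos (by norm_num) (fun u hu => by
      unfold smallSq sqExp
      rw [one_mul]
      split_ifs with h
      · have h1 : 1 / 3 ≤ Real.exp (-u) := by
          have h2 : Real.exp (-1) ≤ Real.exp (-u) := Real.exp_le_exp.2 (by linarith)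
          refine le_trans ?_ h2
          rw [Real.exp_neg, one_div]
          exact inv_anti₀ (Real.exp_pos 1) (by linarith [Real.exp_one_lt_d9])
        nlinarith [sq_nonneg u]
      · positivity) hx

lemma smallSq_transform_le_oneSubCos (hpos : ∀ᵐ s ∂μ, 0 < s) (hμ : Integrable truncSq μ)
    (hv : 0 ≤ v) {x : ℝ} (hx : 0 < x) :
    levyTransform μ v 1 smallSq x ≤ 5 * levyTransform μ v 1 oneSubCos x := by
  simpa using levyTransform_le_mul isLevyKernel_smallSq isLevyKernel_oneSubCos hpos hμ hv
    (a := 1) (a₁ := 1) (A := 5) one_pos (by norm_num) (fun u hu => by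
      have h0 := isLevyKernel_oneSubCos.nonneg u hu
      rw [one_mul]
      unfold smallSq
      split_ifs with h
      · linarith [sq_div_five_le_oneSubCos hu.le (by linarith)]
      · positivity) hx

lemma sqExp_transform_le_truncSq (hpos : ∀ᵐ s ∂μ, 0 < s) (hμ : Integrable truncSq μ)
    (hv : 0 ≤ v) {x : ℝ} (hx : 0 < x) :
    levyTransform μ v 2 sqExp x ≤ 2 * levyTransform μ v 1 truncSq x := by
  simpa using levyTransform_le_mul isLevyKernel_sqExp isLevyKernel_truncSq hpos hμ hv
    (a := 2) (a₁ := 1) (A := 2) one_pos (by norm_num)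
    (fun u hu => by simpa using sqExp_le_truncSq hu) hx

lemma oneSubCos_transform_le_truncSq (hpos : ∀ᵐ s ∂μ, 0 < s) (hμ : Integrable truncSq μ)
    (hv : 0 ≤ v) {x : ℝ} (hx : 0 < x) :
    levyTransform μ v 1 oneSubCos x ≤ 2 * levyTransform μ v 1 truncSq x := by
  simpa using levyTransform_le_mul isLevyKernel_oneSubCos isLevyKernel_truncSq hpos hμ hv
    (a := 1) (a₁ := 1) (A := 2) one_pos (by norm_num)
    (fun u hu => by simpa using oneSubCos_le_truncSq u) hx

lemma truncSq_transform_mul_le (hpos : ∀ᵐ s ∂μ, 0 < s) (hμ : Integrable truncSq μ)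
    (hv : 0 ≤ v) {l : ℝ} (hl : 1 ≤ l) {x : ℝ} (hx : 0 < x) :
    levyTransform μ v 1 truncSq (l * x) ≤ l ^ 2 * levyTransform μ v 1 truncSq x :=
  levyTransform_le_mul isLevyKernel_truncSq isLevyKernel_truncSq hpos hμ hv
    (by linarith) (by linarith) (fun u _ => by
      have hl2 : 1 ≤ l ^ 2 := by nlinarith
      unfold truncSq
      rcases min_cases 1 (u ^ 2) with h | h <;> rw [h.1]
      · exact (min_le_left _ _).trans (by linarith)
      · exact (min_le_right _ _).trans (by rw [mul_pow])) hx

lemma sqExp_transform_mul_le (hpos : ∀ᵐ s ∂μ, 0 < s) (hμ : Integrable truncSq μ)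
    (hv : 0 ≤ v) {l : ℝ} (hl : 1 ≤ l) {x : ℝ} (hx : 0 < x) :
    levyTransform μ v 2 sqExp (l * x) ≤ l ^ 2 * levyTransform μ v 2 sqExp x :=
  levyTransform_le_mul isLevyKernel_sqExp isLevyKernel_sqExp hpos hμ hv
    (by linarith) (by linarith) (fun u hu => by
      have : Real.exp (-(l * u)) ≤ Real.exp (-u) := Real.exp_le_exp.2 (by nlinarith)
      unfold sqExp
      rw [mul_pow, ← mul_assoc]
      gcongr) hx

lemma truncSq_transform_mul_le_add (hpos : ∀ᵐ s ∂μ, 0 < s) (hμ : Integrable truncSq μ)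
    (hv : 0 ≤ v) {l : ℝ} (hl : 1 ≤ l) {x : ℝ} (hx : 0 < x) :
    levyTransform μ v 1 truncSq (l * x) ≤
      l ^ 2 * levyTransform μ v 1 smallSq x + levyTransform μ v 1 truncSq x := by
  simpa using levyTransform_le isLevyKernel_truncSq isLevyKernel_smallSq isLevyKernel_truncSq
    hpos hμ hv (a := 1) (a₁ := 1) (a₂ := 1) (A := l ^ 2) (B := 1) (k := l)
    (by linarith) one_pos one_pos (by linarith) (fun u hu => by
      unfold truncSq smallSq
      rw [one_mul, one_mul]
      split_ifs with h
      · have : 0 ≤ min 1 (u ^ 2) := le_min zero_le_one (sq_nonneg u)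
        exact (min_le_right _ _).trans (by rw [mul_pow]; linarith)
      · rw [min_eq_left (b := u ^ 2) (by nlinarith)]
        exact (min_le_left _ _).trans (by linarith)) hx

lemma sqExp_transform_mul_le_add (hpos : ∀ᵐ s ∂μ, 0 < s) (hμ : Integrable truncSq μ)
    (hv : 0 ≤ v) {M : ℝ} (hM : 0 < M) {x : ℝ} (hx : 0 < x) :
    levyTransform μ v 2 sqExp (M * x) ≤ 2 * M ^ 2 * levyTransform μ v 1 smallSq x +
      4 * Real.exp (-(M / 2)) * levyTransform μ v 2 sqExp (M / 2 * x) := by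
  have hE := Real.exp_pos (-(M / 2))
  simpa using levyTransform_le isLevyKernel_sqExp isLevyKernel_smallSq isLevyKernel_sqExp
    hpos hμ hv (a := 2) (a₁ := 1) (a₂ := 2) (A := 2 * M ^ 2) (B := 4 * Real.exp (-(M / 2)))
    (k := M) (l := 1) (m := M / 2) hM one_pos (by positivity)
    (by nlinarith [mul_nonneg hE.le (sq_nonneg (M / 2))])
    (fun u hu => by
      unfold sqExp smallSq
      rw [one_mul]
      split_ifs with h
      · have h1 : Real.exp (-(M * u)) ≤ 1 := by
          rw [Real.exp_le_one_iff]; nlinarith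
        have h2 : 0 ≤ 4 * Real.exp (-(M / 2)) * ((M / 2 * u) ^ 2 * Real.exp (-(M / 2 * u))) := by
          positivity
        have h3 : (M * u) ^ 2 * Real.exp (-(M * u)) ≤ (M * u) ^ 2 * 1 := by gcongr
        nlinarith [sq_nonneg (M * u)]
      · have h1 : Real.exp (-(M * u)) ≤ Real.exp (-(M / 2)) * Real.exp (-(M / 2 * u)) := by
          rw [← Real.exp_add, Real.exp_le_exp]
          nlinarith
        have h2 := mul_le_mul_of_nonneg_left h1 (sq_nonneg (M * u))
        linarith) hx

/-- A uniform bound of `∫ (1 - cos(txs)) μ(ds)` over `t ∈ [1, 4]` bounds `∫ min(1,(xs)²) μ(ds)`. -/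
lemma integral_truncSq_le [SigmaFinite μ] (hpos : ∀ᵐ s ∂μ, 0 < s) (hμ : Integrable truncSq μ)
    {x B : ℝ} (hx : 0 < x)
    (hB : ∀ t ∈ Icc (1 : ℝ) 4, ∫ s, oneSubCos (t * x * s) ∂μ ≤ B) :
    ∫ s, truncSq (x * s) ∂μ ≤ 9 * B := by
  have hdom : Integrable (Function.uncurry fun s t : ℝ => oneSubCos (t * (x * s)))
      (μ.prod (volume.restrict (Ioc (1 : ℝ) 4))) := by
    have h1 : Integrable (fun p : ℝ × ℝ => 32 * truncSq (x * p.1))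
        (μ.prod (volume.restrict (Ioc (1 : ℝ) 4))) :=
      ((isLevyKernel_truncSq.integrable hpos hμ hx).const_mul 32).comp_fst _
    refine h1.mono' ?_ ?_
    · unfold oneSubCos
      exact Continuous.aestronglyMeasurable (by simp only [Function.uncurry_def]; fun_prop)
    · have h2 : ∀ᵐ p ∂(μ.prod (volume.restrict (Ioc (1 : ℝ) 4))), p.2 ∈ Ioc (1 : ℝ) 4 :=
        Measure.quasiMeasurePreserving_snd.ae (ae_restrict_mem measurableSet_Ioc)
      filter_upwards [h2] with p hp
      have h3 := oneSubCos_le_truncSq (p.2 * (x * p.1))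
      have h4 : truncSq (p.2 * (x * p.1)) ≤ 16 * truncSq (x * p.1) := by
        have h5 : p.2 ^ 2 ≤ 16 := by nlinarith [hp.1, hp.2]
        unfold truncSq
        rcases min_cases 1 ((x * p.1) ^ 2) with h | h <;> rw [h.1]
        · exact (min_le_left _ _).trans (by norm_num)
        · refine (min_le_right _ _).trans ?_
          rw [mul_pow]
          gcongr
      have h6 : 0 ≤ oneSubCos (p.2 * (x * p.1)) := by
        unfold oneSubCos; linarith [Real.cos_le_one (p.2 * (x * p.1))]
      simp only [Function.uncurry_def]
      rw [Real.norm_of_nonneg h6]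
      linarith
  calc ∫ s, truncSq (x * s) ∂μ
      ≤ ∫ s, 3 * (∫ t in Ioc (1 : ℝ) 4, oneSubCos (t * (x * s))) ∂μ := by
        have hi : Integrable (fun s => 3 * ∫ t in Ioc (1 : ℝ) 4, oneSubCos (t * (x * s))) μ :=
          hdom.integral_prod_left.const_mul 3
        refine integral_mono_ae (isLevyKernel_truncSq.integrable hpos hμ hx) hi ?_
        filter_upwards [hpos] with s hs
        have := truncSq_le_integral_oneSubCos (mul_pos hx hs)
        rwa [intervalIntegral.integral_of_le (by norm_num)] at this
    _ = 3 * ∫ t in Ioc (1 : ℝ) 4, ∫ s, oneSubCos (t * (x * s)) ∂μ := by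
        rw [integral_const_mul]
        exact congrArg _ (integral_integral_swap hdom)
    _ ≤ 3 * ∫ _ in Ioc (1 : ℝ) 4, B := by
        refine mul_le_mul_of_nonneg_left ?_ (by norm_num)
        refine setIntegral_mono_on hdom.integral_prod_right (by simp) measurableSet_Ioc ?_
        intro t ht
        simpa only [mul_assoc] using hB t (Ioc_subset_Icc_self ht)
    _ = 9 * B := by
        rw [setIntegral_const]
        norm_num [Measure.real]
        ring

lemma tendsto_truncSq_transform (hμ : Integrable truncSq μ) :
    Tendsto (levyTransform μ v 1 truncSq) (nhds 0) (nhds 0) := by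
  have h1 : Tendsto (fun x => ∫ s, truncSq (x * s) ∂μ) (nhds 0) (nhds (∫ _, (0 : ℝ) ∂μ)) := by
    refine tendsto_integral_filter_of_dominated_convergence truncSq ?_ ?_ hμ ?_
    · refine Eventually.of_forall fun x => Continuous.aestronglyMeasurable ?_
      unfold truncSq; fun_prop
    · filter_upwards [Icc_mem_nhds (show (-1 : ℝ) < 0 by norm_num) zero_lt_one] with x hx
      refine Eventually.of_forall fun s => ?_
      unfold truncSq
      rw [Real.norm_of_nonneg (le_min zero_le_one (sq_nonneg _)), mul_pow]
      have : x ^ 2 ≤ 1 := by nlinarith [hx.1, hx.2]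
      exact min_le_min le_rfl (by nlinarith [sq_nonneg s])
    · refine Eventually.of_forall fun s => ?_
      have : Continuous fun x : ℝ => truncSq (x * s) := by unfold truncSq; fun_prop
      simpa [truncSq] using this.tendsto 0
  have h2 : Tendsto (fun x : ℝ => v * 1 * x ^ 2) (nhds 0) (nhds 0) := by
    have : Continuous fun x : ℝ => v * 1 * x ^ 2 := by fun_prop
    simpa using this.tendsto 0
  have h3 := h2.add h1
  rw [integral_zero, add_zero] at h3
  exact h3

/-- At a fixed point, the Pruitt transform is dominated by a multiple of the `u² e^{-u}` one. -/
lemma exists_truncSq_transform_le_mul (hpos : ∀ᵐ s ∂μ, 0 < s) (hμ : Integrable truncSq μ)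
    (hv : 0 ≤ v) {x : ℝ} (hx : 0 < x) :
    ∃ C, 0 ≤ C ∧ levyTransform μ v 1 truncSq x ≤ C * levyTransform μ v 2 sqExp x := by
  have hP := levyTransform_nonneg isLevyKernel_sqExp hpos hv zero_le_two hx
  have hH := levyTransform_nonneg isLevyKernel_truncSq hpos hv zero_le_one hx
  rcases hP.eq_or_lt with h0 | hpos'
  · refine ⟨0, le_rfl, ?_⟩
    have hnn : 0 ≤ᵐ[μ] fun s => sqExp (x * s) := by
      filter_upwards [hpos] with s hs
      exact isLevyKernel_sqExp.nonneg _ (mul_pos hx hs)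
    have hI := integral_nonneg_of_ae hnn
    have hvx : 0 ≤ v * x ^ 2 := by positivity
    unfold levyTransform at h0
    have hI0 : ∫ s, sqExp (x * s) ∂μ = 0 := by linarith
    have hv0 : v * x ^ 2 = 0 := by linarith
    have hae := (integral_eq_zero_iff_of_nonneg_ae hnn
      (isLevyKernel_sqExp.integrable hpos hμ hx)).1 hI0
    have hfalse : (fun s => truncSq (x * s)) =ᵐ[μ] 0 := by
      filter_upwards [hpos, hae] with s hs h
      have : 0 < sqExp (x * s) := by have := mul_pos hx hs; unfold sqExp; positivity
      exact absurd h this.ne'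
    unfold levyTransform
    rw [integral_congr_ae hfalse]
    simp [hv0]
  · exact ⟨_, div_nonneg hH hpos'.le, (div_mul_cancel₀ _ hpos'.ne').ge⟩

end Transform

lemma exists_one_le_mul_rpow {c α : ℝ} (hc : 0 < c) (hα : 0 < α) (N : ℝ) :
    ∃ L : ℝ, 1 < L ∧ N ≤ c * L ^ α := by
  have h := ((tendsto_rpow_atTop hα).const_mul_atTop hc)
  obtain ⟨L, h1, h2⟩ := ((h.eventually_ge_atTop N).and (eventually_gt_atTop 1)).exists
  exact ⟨L, h2, h1⟩

/-- Lower scaling transfers between comparable functions, at the cost of the constant. -/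
lemma WLSC.of_comparable {f g : ℝ → ℝ} {τ c x₀ A B : ℝ} (hx₀ : 0 ≤ x₀) (hf : WLSC f τ c x₀)
    (hc : 0 < c) (hg : ∀ x, x₀ < x → 0 ≤ g x) (hA : 0 < A) (hB : 0 < B)
    (h₁ : ∀ x, x₀ < x → f x ≤ A * g x) (h₂ : ∀ x, x₀ < x → g x ≤ B * f x) :
    ∃ c' ∈ Ioc (0 : ℝ) 1, WLSC g τ c' x₀ := by
  refine ⟨min 1 (c / (A * B)), ⟨lt_min one_pos (by positivity), min_le_left _ _⟩, ?_⟩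
  intro l hl x hx
  have hlx : x₀ < l * x := by nlinarith
  have hlt : 0 < l ^ τ := Real.rpow_pos_of_pos (by linarith) _
  calc min 1 (c / (A * B)) * l ^ τ * g x
      ≤ c / (A * B) * l ^ τ * g x := by
        have := hg x hx
        gcongr
        exact min_le_right _ _
    _ ≤ c / (A * B) * l ^ τ * (B * f x) := by
        gcongr
        exact h₂ x hx
    _ = (c * l ^ τ * f x) / A := by field_simp
    _ ≤ f (l * x) / A := by gcongr; exact hf l hl x hx
    _ ≤ g (l * x) := by rw [div_le_iff₀' hA]; exact h₁ _ hlx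

section Scaling

variable {μ : Measure ℝ} {v α c x₀ : ℝ}

lemma exists_sqExp_transform_le_smallSq (hpos : ∀ᵐ s ∂μ, 0 < s) (hμ : Integrable truncSq μ)
    (hv : 0 ≤ v) (hα : 0 < α) (hx₀ : 0 ≤ x₀) (hc : 0 < c)
    (h : WLSC (levyTransform μ v 2 sqExp) α c x₀) :
    ∃ C, 0 < C ∧ ∀ x, x₀ < x →
      levyTransform μ v 2 sqExp x ≤ C * levyTransform μ v 1 smallSq x := by
  obtain ⟨M, hM2, hM⟩ : ∃ M : ℝ, 2 ≤ M ∧ 4 * Real.exp (-(M / 2)) ≤ c / 2 := by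
    have ht : Tendsto (fun M : ℝ => 4 * Real.exp (-(M / 2))) atTop (nhds (4 * 0)) :=
      (Real.tendsto_exp_neg_atTop_nhds_zero.comp
        (tendsto_id.atTop_div_const (by norm_num : (0 : ℝ) < 2))).const_mul 4
    rw [mul_zero] at ht
    obtain ⟨M, h1, h2⟩ := ((ht.eventually (ge_mem_nhds (half_pos hc))).and
      (eventually_ge_atTop 2)).exists
    exact ⟨M, h2, h1⟩
  refine ⟨4 * M ^ 2 / c, by positivity, fun x hx => ?_⟩
  have hx0 : 0 < x := by linarith
  have h1 := sqExp_transform_mul_le_add hpos hμ hv (M := M) (by linarith) hx0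
  have hP := levyTransform_nonneg isLevyKernel_sqExp hpos hv zero_le_two
    (mul_pos (show 0 < M / 2 by linarith) hx0)
  have hPx := levyTransform_nonneg isLevyKernel_sqExp hpos hv zero_le_two hx0
  have h2 := h 2 one_le_two (M / 2 * x) (by nlinarith)
  have h3 := h M (by linarith) x hx
  rw [show 2 * (M / 2 * x) = M * x by ring] at h2
  have h4 : (1 : ℝ) ≤ 2 ^ α := Real.one_le_rpow one_le_two hα.le
  have h5 : (1 : ℝ) ≤ M ^ α := Real.one_le_rpow (by linarith) hα.le
  have h6 : c * levyTransform μ v 2 sqExp (M / 2 * x) ≤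
      c * 2 ^ α * levyTransform μ v 2 sqExp (M / 2 * x) := by
    gcongr; nlinarith
  have h7 : c * levyTransform μ v 2 sqExp x ≤ c * M ^ α * levyTransform μ v 2 sqExp x := by
    gcongr; nlinarith
  have h8 := mul_le_mul_of_nonneg_right hM hP
  rw [div_mul_eq_mul_div, le_div_iff₀ hc]
  linarith

lemma exists_truncSq_transform_le_sqExp (hpos : ∀ᵐ s ∂μ, 0 < s) (hμ : Integrable truncSq μ)
    (hv : 0 ≤ v) (hα : 0 < α) (hx₀ : 0 ≤ x₀) (hc : 0 < c)
    (h : WLSC (levyTransform μ v 2 sqExp) α c x₀) :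
    ∃ C, 0 < C ∧ ∀ x, x₀ < x →
      levyTransform μ v 1 truncSq x ≤ C * levyTransform μ v 2 sqExp x := by
  obtain ⟨L, hL1, hL⟩ := exists_one_le_mul_rpow hc hα 2
  have hL0 : 0 < L := by linarith
  have iter : ∀ y, x₀ < y → ∀ n : ℕ, levyTransform μ v 1 truncSq (L ^ n * y) ≤
      levyTransform μ v 1 truncSq y + 3 * L ^ 2 * levyTransform μ v 2 sqExp (L ^ n * y) := by
    intro y hy n
    have hy0 : 0 < y := by linarith
    induction n with
    | zero =>
      have := levyTransform_nonneg isLevyKernel_sqExp hpos hv zero_le_two hy0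
      simp only [pow_zero, one_mul]
      nlinarith [mul_nonneg (sq_nonneg L) this]
    | succ n ih =>
      have hz : 0 < L ^ n * y := by positivity
      have hz0 : x₀ < L ^ n * y := by nlinarith [one_le_pow₀ (n := n) hL1.le]
      have hP := levyTransform_nonneg isLevyKernel_sqExp hpos hv zero_le_two hz
      have h1 := truncSq_transform_mul_le_add hpos hμ hv hL1.le hz
      have h2 := smallSq_transform_le_sqExp hpos hμ hv hz
      have h3 := (mul_le_mul_of_nonneg_right hL hP).trans (h L hL1.le _ hz0)
      rw [← mul_assoc, ← pow_succ'] at h1 h3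
      nlinarith [mul_le_mul_of_nonneg_left h2 (sq_nonneg L),
        mul_le_mul_of_nonneg_left h3 (sq_nonneg L)]
  rcases hx₀.eq_or_lt with rfl | hx₀
  · refine ⟨3 * L ^ 2, by positivity, fun x hx => ?_⟩
    have ht : Tendsto (fun n : ℕ => x / L ^ n) atTop (nhds 0) :=
      (tendsto_pow_atTop_atTop_of_one_lt hL1).const_div_atTop x
    have ht' := ((tendsto_truncSq_transform (v := v) hμ).comp ht).add_const
      (3 * L ^ 2 * levyTransform μ v 2 sqExp x)
    rw [zero_add] at ht'
    refine ge_of_tendsto' ht' fun n => ?_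
    have := iter (x / L ^ n) (by positivity) n
    rwa [mul_div_cancel₀ _ (by positivity : L ^ n ≠ 0)] at this
  · obtain ⟨C, hC0, hC⟩ := exists_truncSq_transform_le_mul hpos hμ hv (mul_pos hL0 hx₀)
    refine ⟨C * (L ^ 2 / c) + 3 * L ^ 2, by positivity, fun x hx => ?_⟩
    obtain ⟨k, hk1, hk2⟩ := exists_mem_Ioc_zpow (div_pos (hx₀.trans hx) hx₀) hL1
    have hk0 : 0 ≤ k := by
      have h1 : L ^ (0 : ℤ) < L ^ (k + 1) := by
        rw [zpow_zero]; exact ((one_lt_div hx₀).2 hx).trans_le hk2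
      have := (zpow_lt_zpow_iff_right₀ hL1).1 h1
      omega
    obtain ⟨n, rfl⟩ := Int.eq_ofNat_of_zero_le hk0
    rw [zpow_natCast, lt_div_iff₀ hx₀] at hk1
    rw [← Nat.cast_succ, zpow_natCast, div_le_iff₀ hx₀, pow_succ, mul_assoc] at hk2
    have hLn : 0 < L ^ n := by positivity
    obtain ⟨y, rfl⟩ : ∃ y, x = L ^ n * y := ⟨x / L ^ n, by field_simp⟩
    have hy1 : x₀ < y := lt_of_mul_lt_mul_left hk1 hLn.le
    have hy2 : y ≤ L * x₀ := le_of_mul_le_mul_left hk2 hLn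
    have hy0 : 0 < y := by linarith
    have hLn1 : 1 ≤ L ^ n := one_le_pow₀ hL1.le
    have hPy := levyTransform_nonneg isLevyKernel_sqExp hpos hv zero_le_two hy0
    have hH : levyTransform μ v 1 truncSq y ≤ levyTransform μ v 1 truncSq (L * x₀) := by
      have hyl : 0 < y / (L * x₀) := by positivity
      have hyl1 : y / (L * x₀) ≤ 1 := (div_le_one (by positivity)).2 hy2
      have hyl2 : (y / (L * x₀)) ^ 2 ≤ 1 := by nlinarith
      have := levyTransform_le_mul isLevyKernel_truncSq isLevyKernel_truncSq hpos hμ hv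
        (a := 1) (a₁ := 1) (A := 1) hyl (by linarith) (fun u hu => by
          unfold truncSq
          rw [one_mul, mul_pow]
          exact min_le_min le_rfl (by nlinarith [sq_nonneg u])) (mul_pos hL0 hx₀)
      rwa [div_mul_cancel₀ _ (by positivity), one_mul] at this
    have hP1 : levyTransform μ v 2 sqExp (L * x₀) ≤ L ^ 2 * levyTransform μ v 2 sqExp y := by
      have hl1 : 1 ≤ L * x₀ / y := (one_le_div hy0).2 hy2
      have := sqExp_transform_mul_le hpos hμ hv hl1 hy0
      rw [div_mul_cancel₀ _ hy0.ne'] at this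
      refine this.trans (mul_le_mul_of_nonneg_right ?_ hPy)
      have : L * x₀ / y ≤ L := by rw [div_le_iff₀ hy0]; gcongr
      gcongr
    have hP2 : c * levyTransform μ v 2 sqExp y ≤ levyTransform μ v 2 sqExp (L ^ n * y) := by
      refine le_trans ?_ (h _ hLn1 y hy1)
      have := Real.one_le_rpow hLn1 hα.le
      gcongr
      nlinarith
    have hP3 : levyTransform μ v 2 sqExp y ≤ levyTransform μ v 2 sqExp (L ^ n * y) / c := by
      rwa [le_div_iff₀' hc]
    calc levyTransform μ v 1 truncSq (L ^ n * y)
        ≤ levyTransform μ v 1 truncSq y + 3 * L ^ 2 * levyTransform μ v 2 sqExp (L ^ n * y) :=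
          iter y hy1 n
      _ ≤ C * (L ^ 2 * (levyTransform μ v 2 sqExp (L ^ n * y) / c)) +
          3 * L ^ 2 * levyTransform μ v 2 sqExp (L ^ n * y) := by
        gcongr
        exact (hH.trans hC).trans (by gcongr; exact hP1.trans (by gcongr))
      _ = _ := by ring

lemma WLSC.oneSubCos_of_sqExp (hpos : ∀ᵐ s ∂μ, 0 < s) (hμ : Integrable truncSq μ)
    (hv : 0 ≤ v) (hα : 0 < α) (hx₀ : 0 ≤ x₀) (hc : 0 < c)
    (h : WLSC (levyTransform μ v 2 sqExp) α c x₀) :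
    ∃ c' ∈ Ioc (0 : ℝ) 1, WLSC (levyTransform μ v 1 oneSubCos) α c' x₀ := by
  obtain ⟨C₁, hC₁, h₁⟩ := exists_sqExp_transform_le_smallSq hpos hμ hv hα hx₀ hc h
  obtain ⟨C₂, hC₂, h₂⟩ := exists_truncSq_transform_le_sqExp hpos hμ hv hα hx₀ hc h
  refine h.of_comparable (A := C₁ * 5) (B := 2 * C₂) hx₀ hc (fun x hx => ?_) (by positivity)
    (by positivity) (fun x hx => ?_) (fun x hx => ?_)
  · exact levyTransform_nonneg isLevyKernel_oneSubCos hpos hv zero_le_one (hx₀.trans_lt hx)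
  · rw [mul_assoc]
    refine (h₁ x hx).trans ?_
    gcongr
    exact smallSq_transform_le_oneSubCos hpos hμ hv (hx₀.trans_lt hx)
  · rw [mul_assoc]
    refine (oneSubCos_transform_le_truncSq hpos hμ hv (hx₀.trans_lt hx)).trans ?_
    gcongr
    exact h₂ x hx

lemma truncSq_transform_le_oneSubCos [SigmaFinite μ] (hpos : ∀ᵐ s ∂μ, 0 < s)
    (hμ : Integrable truncSq μ) (hv : 0 ≤ v) (hα : 0 < α) (hx₀ : 0 ≤ x₀) (hc : c ∈ Ioc (0 : ℝ) 1)
    (h : WLSC (levyTransform μ v 1 oneSubCos) α c x₀) {x : ℝ} (hx : x₀ < x) :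
    levyTransform μ v 1 truncSq x ≤ 10 / c * levyTransform μ v 1 oneSubCos (4 * x) := by
  obtain ⟨hc0, hc1⟩ := hc
  have hx0 : 0 < x := hx₀.trans_lt hx
  have hQ := levyTransform_nonneg isLevyKernel_oneSubCos hpos hv zero_le_one
    (mul_pos four_pos hx0)
  have key := integral_truncSq_le (B := levyTransform μ v 1 oneSubCos (4 * x) / c) hpos hμ hx0
    (fun t ht => by
      have ht0 : 0 < t := by linarith [ht.1]
      have htx : 0 < t * x := by positivity
      have hl : 1 ≤ 4 / t := (one_le_div ht0).2 ht.2
      have h1 := h _ hl (t * x) (by nlinarith [ht.1])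
      rw [← mul_assoc, div_mul_cancel₀ _ ht0.ne'] at h1
      have h2 := Real.one_le_rpow hl hα.le
      have h3 := levyTransform_nonneg isLevyKernel_oneSubCos hpos hv zero_le_one htx
      have h4 : ∫ s, oneSubCos (t * x * s) ∂μ ≤ levyTransform μ v 1 oneSubCos (t * x) :=
        le_add_of_nonneg_left (by positivity)
      rw [le_div_iff₀' hc0]
      calc c * ∫ s, oneSubCos (t * x * s) ∂μ ≤ c * levyTransform μ v 1 oneSubCos (t * x) := by
            gcongr
        _ ≤ c * (4 / t) ^ α * levyTransform μ v 1 oneSubCos (t * x) := by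
            gcongr
            nlinarith
        _ ≤ _ := h1)
  have h5 : v * 1 * x ^ 2 ≤ levyTransform μ v 1 oneSubCos (4 * x) := by
    have h6 : 0 ≤ ∫ s, oneSubCos (4 * x * s) ∂μ := by
      refine integral_nonneg fun s => ?_
      have := Real.cos_le_one (4 * x * s)
      simp only [oneSubCos, Pi.zero_apply]
      linarith
    have h7 : 0 ≤ v * x ^ 2 := by positivity
    unfold levyTransform
    nlinarith
  have h8 : levyTransform μ v 1 oneSubCos (4 * x) ≤
      levyTransform μ v 1 oneSubCos (4 * x) / c := by
    rw [le_div_iff₀ hc0]; nlinarith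
  calc levyTransform μ v 1 truncSq x
      ≤ levyTransform μ v 1 oneSubCos (4 * x) / c +
        9 * (levyTransform μ v 1 oneSubCos (4 * x) / c) := add_le_add (h5.trans h8) key
    _ = _ := by ring

lemma WLSC.sqExp_of_oneSubCos [SigmaFinite μ] (hpos : ∀ᵐ s ∂μ, 0 < s)
    (hμ : Integrable truncSq μ) (hv : 0 ≤ v) (hα : 0 < α) (hx₀ : 0 ≤ x₀) (hc : c ∈ Ioc (0 : ℝ) 1)
    (h : WLSC (levyTransform μ v 1 oneSubCos) α c x₀) :
    ∃ c' ∈ Ioc (0 : ℝ) 1, WLSC (levyTransform μ v 2 sqExp) α c' x₀ := by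
  have hc0 : 0 < c := hc.1
  have hdil : WLSC (fun x => levyTransform μ v 1 oneSubCos (4 * x)) α c x₀ := by
    intro l hl x hx
    have := h l hl (4 * x) (by linarith)
    rwa [mul_left_comm] at this
  obtain ⟨c', hc', hH⟩ := hdil.of_comparable (g := levyTransform μ v 1 truncSq)
    (A := 32) (B := 10 / c) hx₀ hc0
    (fun x hx => levyTransform_nonneg isLevyKernel_truncSq hpos hv zero_le_one (hx₀.trans_lt hx))
    (by norm_num) (by positivity)
    (fun x hx => by
      have hx0 := hx₀.trans_lt hx
      have h1 := oneSubCos_transform_le_truncSq hpos hμ hv (mul_pos four_pos hx0)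
      have h2 := truncSq_transform_mul_le hpos hμ hv (by norm_num : (1 : ℝ) ≤ 4) hx0
      linarith)
    (fun x hx => truncSq_transform_le_oneSubCos hpos hμ hv hα hx₀ hc h hx)
  obtain ⟨L, hL1, hL⟩ := exists_one_le_mul_rpow hc'.1 hα 2
  refine hH.of_comparable (A := 3 * L ^ 2) (B := 2) hx₀ hc'.1
    (fun x hx => levyTransform_nonneg isLevyKernel_sqExp hpos hv zero_le_two (hx₀.trans_lt hx))
    (by positivity) two_pos (fun x hx => ?_)
    (fun x hx => sqExp_transform_le_truncSq hpos hμ hv (hx₀.trans_lt hx))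
  have hx0 := hx₀.trans_lt hx
  have h1 := hH L hL1.le x hx
  have h2 := truncSq_transform_mul_le_add hpos hμ hv hL1.le hx0
  have h3 := mul_le_mul_of_nonneg_right hL
    (levyTransform_nonneg isLevyKernel_truncSq hpos hv zero_le_one hx0)
  have h4 := mul_le_mul_of_nonneg_left (smallSq_transform_le_sqExp hpos hμ hv hx0) (sq_nonneg L)
  linarith

end Scaling

/-- Multiplying by `x²` raises the scaling exponent by two. -/
lemma wlsc_sub_two_iff {f g : ℝ → ℝ} {α c x₀ : ℝ} (hx₀ : 0 ≤ x₀)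
    (hg : ∀ x, 0 < x → g x = x ^ 2 * f x) : WLSC f (α - 2) c x₀ ↔ WLSC g α c x₀ := by
  refine forall₄_congr fun l hl x hx => ?_
  have hx0 : 0 < x := hx₀.trans_lt hx
  have hl0 : 0 < l := by linarith
  have hlx : 0 < (l * x) ^ 2 := by positivity
  rw [hg x hx0, hg _ (mul_pos hl0 hx0), ← mul_le_mul_iff_right₀ hlx,
    Real.rpow_sub hl0, Real.rpow_two]
  have : (l * x) ^ 2 * (c * (l ^ α / l ^ 2) * f x) = c * l ^ α * (x ^ 2 * f x) := by
    field_simp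
  rw [this]

/-- Corollary 5. -/
theorem statement12
    (ν : Measure ℝ) [SigmaFinite ν]
    (hint : ∫⁻ x in Ioi (0:ℝ), ENNReal.ofReal (min 1 (x ^ 2)) ∂ν ≠ ⊤)
    (σ b : ℝ) (hσ : 0 ≤ σ)
    (φ φ' φ'' : ℝ → ℝ)
    (hφ : ∀ l : ℝ, 0 ≤ l → φ l = σ ^ 2 * l ^ 2 - b * l +
      ∫ x in Ioi (0:ℝ), (Real.exp (-(l * x)) - 1 + l * x * (if x < 1 then 1 else 0)) ∂ν)
    (hD1 : ∀ x : ℝ, 0 < x → HasDerivAt φ (φ' x) x)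
    (hD2 : ∀ x : ℝ, 0 < x → HasDerivAt φ' (φ'' x) x)
    (hφ'' : ∀ l : ℝ, 0 < l → φ'' l = 2 * σ ^ 2 + ∫ x in Ioi (0:ℝ), x ^ 2 * Real.exp (-(l * x)) ∂ν)
    (α x₀ : ℝ) (hα : 0 < α) (hx₀ : 0 ≤ x₀) :
    (∃ c : ℝ, c ∈ Ioc (0:ℝ) 1 ∧ WLSC φ'' (α - 2) c x₀) ↔
    (∃ c' : ℝ, c' ∈ Ioc (0:ℝ) 1 ∧ WLSC (rePsi σ ν) α c' x₀) := by
  have hpos : ∀ᵐ s ∂ν.restrict (Ioi 0), (0 : ℝ) < s := ae_restrict_mem measurableSet_Ioi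
  have hμ : Integrable truncSq (ν.restrict (Ioi 0)) := by
    refine ⟨isLevyKernel_truncSq.measurable.aestronglyMeasurable, ?_⟩
    refine (hasFiniteIntegral_iff_ofReal (f := truncSq)
      (Eventually.of_forall fun s => le_min zero_le_one (sq_nonneg s))).2 hint.lt_top
  have hv : 0 ≤ σ ^ 2 := sq_nonneg σ
  have hP : ∀ x, 0 < x →
      levyTransform (ν.restrict (Ioi 0)) (σ ^ 2) 2 sqExp x = x ^ 2 * φ'' x := by
    intro x hx
    rw [hφ'' x hx, mul_add, ← integral_const_mul]
    unfold levyTransform sqExp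
    congr 1
    · ring
    · refine integral_congr_ae (Eventually.of_forall fun s => ?_)
      simp only [mul_pow, mul_assoc]
  have hQ : rePsi σ ν = levyTransform (ν.restrict (Ioi 0)) (σ ^ 2) 1 oneSubCos := by
    funext x
    simp [rePsi, levyTransform, oneSubCos]
  simp only [wlsc_sub_two_iff hx₀ hP, hQ]
  constructor
  · rintro ⟨c, hc, h⟩
    exact h.oneSubCos_of_sqExp hpos hμ hv hα hx₀ hc.1
  · rintro ⟨c, hc, h⟩
    exact h.sqExp_of_oneSubCos hpos hμ hv hα hx₀ hc

end
end
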